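/- Let A be an irreducible k×k matrix with entries in {0,1}. Then there exists a map μ(·) : [0,1] → M_inv(σ, Σ_A), continuous with respect to the weak* topology on the set M_inv(σ, Σ_A) of σ-invariant Borel probability measures on Σ_A, such that: (1) h_{μ(0)}(σ) = 0 and μ(1) is the unique measure of maximal entropy, so h_{μ(1)}(σ) = h_top(σ, Σ_A); (2) for every t ∈ (0,1], the measure μ(t) is ergodic; (3) the map t ↦ h_{μ(t)}(σ) is continuous on [0,1]. -/

import Mathlib

open MeasureTheory Real Filter Set

/-- The shift map on the full shift `ℤ → S`. -/
def shiftMap {S : Type*} : (ℤ → S) → (ℤ → S) := fun x i => x (i + 1)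

/-- The subshift of finite type determined by the 0-1 matrix `A : S → S → ℕ`. -/
def SFT {S : Type*} (A : S → S → ℕ) : Set (ℤ → S) :=
  {x | ∀ i : ℤ, A (x i) (x (i + 1)) = 1}

/-- `w : Fin n → S` is an admissible word for the 0-1 matrix `A`. -/
def IsAdmissible {S : Type*} (A : S → S → ℕ) {n : ℕ} (w : Fin n → S) : Prop :=
  ∀ (i : ℕ) (h : i + 1 < n), A (w ⟨i, Nat.lt_of_succ_lt h⟩) (w ⟨i + 1, h⟩) = 1

/-- The shift map restricted to the SFT determined by `A`. -/
def restrictShift {S : Type*} (A : S → S → ℕ) (x : ↥(SFT A)) : ↥(SFT A) :=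
  ⟨shiftMap x.1, fun i => x.2 (i + 1)⟩

open Classical in
/-- The `n`-block recoding matrix `A_n`, indexed by admissible words of length `n`:
`(b,b')`-entry is 1 iff the last `n-1` letters of `b` coincide with the first `n-1`
letters of `b'`. -/
noncomputable def blockMatrix {S : Type*} (A : S → S → ℕ) (n : ℕ) :
    {w : Fin n → S // IsAdmissible A w} → {w : Fin n → S // IsAdmissible A w} → ℕ :=
  fun b b' =>
    if ∀ (p : ℕ) (h : p + 1 < n), b.1 ⟨p + 1, h⟩ = b'.1 ⟨p, Nat.lt_of_succ_lt h⟩ then 1 else 0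

open Classical in
/-- `m`-th power of the matrix `A : S → S → ℕ`. -/
noncomputable def matPow {S : Type*} [Fintype S] (A : S → S → ℕ) : ℕ → S → S → ℕ
  | 0 => fun i j => if i = j then 1 else 0
  | (m + 1) => fun i j => ∑ r : S, matPow A m i r * A r j

/-- A nonnegative matrix is irreducible if for every `(i,j)` some power has positive
`(i,j)`-entry. -/
def IrreducibleMat {S : Type*} [Fintype S] (A : S → S → ℕ) : Prop :=
  ∀ i j : S, ∃ m : ℕ, 1 ≤ m ∧ 0 < matPow A m i j

noncomputable instance wordsFintype {S : Type*} [Fintype S] (A : S → S → ℕ) (n : ℕ) :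
    Fintype {w : Fin n → S // IsAdmissible A w} := Fintype.ofFinite _

/-- Shannon entropy of the partition of the full shift into cylinders of length `n`
(based at coordinates `0, …, n-1`). -/
noncomputable def blockH {k : ℕ} (μ : Measure (ℤ → Fin k)) (n : ℕ) : ℝ :=
  ∑ w : Fin n → Fin k,
    Real.negMulLog (μ {x | ∀ p : Fin n, x ((p : ℕ) : ℤ) = w p}).toReal

/-- The measure-theoretic (Kolmogorov–Sinai) entropy of a shift-invariant measure `μ`
on the full shift: since the coordinate partition is generating and `blockH μ` is
subadditive, it equals `inf_{n ≥ 1} blockH μ n / n`. -/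
noncomputable def mEntropy {k : ℕ} (μ : Measure (ℤ → Fin k)) : ℝ :=
  ⨅ n : ℕ, blockH μ (n + 1) / (n + 1)

/-- The number of admissible words of length `n` for `A`. -/
noncomputable def wordCount {k : ℕ} (A : Fin k → Fin k → ℕ) (n : ℕ) : ℕ :=
  Nat.card {w : Fin n → Fin k // IsAdmissible A w}

/-- The topological entropy of the SFT determined by an irreducible matrix `A`:
the exponential growth rate of the number of admissible words, which by
subadditivity equals `inf_{n ≥ 1} (log wordCount n) / n`. -/
noncomputable def topEnt {k : ℕ} (A : Fin k → Fin k → ℕ) : ℝ :=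
  ⨅ n : ℕ, Real.log (wordCount A (n + 1)) / (n + 1)

/-- `μ` is a `σ`-invariant Borel probability measure carried by the SFT `Σ_A`. -/
def InvProbOn {k : ℕ} (A : Fin k → Fin k → ℕ) (μ : Measure (ℤ → Fin k)) : Prop :=
  IsProbabilityMeasure μ ∧ MeasurePreserving shiftMap μ μ ∧ μ (SFT A) = 1

section Words

variable {S : Type*}

/-- The word `w` followed by the letter `b`. -/
def wordSnoc {n : ℕ} (w : Fin n → S) (b : S) : Fin (n + 1) → S :=
  Fin.snoc (α := fun _ => S) w b

/-- The word `w` preceded by the letter `a`. -/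
def wordCons {n : ℕ} (a : S) (w : Fin n → S) : Fin (n + 1) → S :=
  Fin.cons (α := fun _ => S) a w

@[simp] lemma wordSnoc_castSucc {n : ℕ} (w : Fin n → S) (b : S) (i : Fin n) :
    wordSnoc w b i.castSucc = w i := by simp [wordSnoc]

@[simp] lemma wordSnoc_last {n : ℕ} (w : Fin n → S) (b : S) :
    wordSnoc w b (Fin.last n) = b := by simp [wordSnoc]

@[simp] lemma wordCons_succ {n : ℕ} (a : S) (w : Fin n → S) (i : Fin n) :
    wordCons a w i.succ = w i := by simp [wordCons]

@[simp] lemma wordCons_zero {n : ℕ} (a : S) (w : Fin n → S) : wordCons a w 0 = a := by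
  simp [wordCons]

lemma wordCons_wordSnoc {n : ℕ} (a : S) (w : Fin n → S) (b : S) :
    wordCons a (wordSnoc w b) = wordSnoc (wordCons a w) b :=
  Fin.cons_snoc_eq_snoc_cons (β := S) a w b

lemma exists_eq_wordSnoc {n : ℕ} (w : Fin (n + 1) → S) :
    ∃ (v : Fin n → S) (b : S), w = wordSnoc v b :=
  ⟨Fin.init w, w (Fin.last n), (Fin.snoc_init_self w).symm⟩

variable [Fintype S]

lemma sum_words_snoc {n : ℕ} (F : (Fin (n + 1) → S) → ℝ) :
    ∑ w, F w = ∑ w : Fin n → S, ∑ b, F (wordSnoc w b) := by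
  rw [← (Fin.snocEquiv (fun _ : Fin (n + 1) => S)).sum_comp, Fintype.sum_prod_type_right]
  rfl

lemma sum_words_cons {n : ℕ} (F : (Fin (n + 1) → S) → ℝ) :
    ∑ w, F w = ∑ a, ∑ w : Fin n → S, F (wordCons a w) := by
  rw [← (Fin.consEquiv (fun _ : Fin (n + 1) => S)).sum_comp, Fintype.sum_prod_type]
  rfl

lemma sum_words_zero (F : (Fin 0 → S) → ℝ) (w : Fin 0 → S) : ∑ v, F v = F w := by
  rw [Fintype.sum_unique]
  congr 1
  exact Subsingleton.elim _ _

lemma sum_words_one (F : (Fin 1 → S) → ℝ) : ∑ w, F w = ∑ a, F (fun _ => a) := by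
  rw [sum_words_cons]
  refine Finset.sum_congr rfl fun a _ => ?_
  rw [sum_words_zero _ Fin.elim0]
  congr 1
  ext i
  rw [Fin.fin_one_eq_zero i, wordCons_zero]

end Words

/-- Gibbs' inequality. -/
lemma gibbs_le {ι : Type*} [Fintype ι] {p r : ι → ℝ} (hp : ∀ i, 0 ≤ p i) (hr : ∀ i, 0 ≤ r i)
    (h0 : ∀ i, p i ≠ 0 → r i ≠ 0) (hsum : ∑ i, r i ≤ ∑ i, p i) :
    ∑ i, p i * (log (r i) - log (p i)) ≤ 0 ∧
      (∑ i, p i * (log (r i) - log (p i)) = 0 → ∀ i, p i = r i) := by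
  have key : ∀ i, p i * (log (r i) - log (p i)) ≤ r i - p i ∧
      (p i * (log (r i) - log (p i)) = r i - p i → p i = r i) := by
    intro i
    rcases eq_or_ne (p i) 0 with h | h
    · simp only [h, zero_mul, sub_zero]
      exact ⟨hr i, id⟩
    · have hpi : 0 < p i := lt_of_le_of_ne (hp i) h.symm
      have hri : 0 < r i := lt_of_le_of_ne (hr i) (h0 i h).symm
      rw [← Real.log_div hri.ne' hpi.ne']
      have e : r i - p i = p i * (r i / p i - 1) := by field_simp
      rw [e]
      refine ⟨mul_le_mul_of_nonneg_left (Real.log_le_sub_one_of_pos (by positivity)) hpi.le, ?_⟩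
      intro heq
      by_contra hne
      have h1 : r i / p i ≠ 1 := by
        intro h1
        rw [div_eq_one_iff_eq h] at h1
        exact hne h1.symm
      have := Real.log_lt_sub_one_of_pos (by positivity : 0 < r i / p i) h1
      exact (mul_lt_mul_of_pos_left this hpi).ne heq
  have hle : ∑ i, p i * (log (r i) - log (p i)) ≤ ∑ i, (r i - p i) :=
    Finset.sum_le_sum fun i _ => (key i).1
  have hs : ∑ i, (r i - p i) ≤ 0 := by
    rw [Finset.sum_sub_distrib]
    linarith
  refine ⟨hle.trans hs, fun h i => (key i).2 ?_⟩
  have heq : ∑ i, p i * (log (r i) - log (p i)) = ∑ i, (r i - p i) := by linarith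
  exact (Finset.sum_eq_sum_iff_of_le fun i _ => (key i).1).1 heq i (Finset.mem_univ i)

section WordLaw

variable {S : Type*} [Fintype S]

/-- The word probabilities of a stationary process with values in `S`. -/
structure IsWordLaw (m : ∀ n : ℕ, (Fin n → S) → ℝ) : Prop where
  nonneg : ∀ n w, 0 ≤ m n w
  nil : ∀ w, m 0 w = 1
  sum_snoc : ∀ n w, ∑ b, m (n + 1) (wordSnoc w b) = m n w
  sum_cons : ∀ n w, ∑ a, m (n + 1) (wordCons a w) = m n w

/-- The Shannon entropy of the words of length `n`. -/
noncomputable def wordEntropy (m : ∀ n : ℕ, (Fin n → S) → ℝ) (n : ℕ) : ℝ :=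
  ∑ w, negMulLog (m n w)

namespace IsWordLaw

variable {m : ∀ n : ℕ, (Fin n → S) → ℝ}

lemma sum_eq_one (hm : IsWordLaw m) (n : ℕ) : ∑ w, m n w = 1 := by
  induction n with
  | zero => rw [sum_words_zero _ Fin.elim0, hm.nil]
  | succ n ih => rw [sum_words_snoc, ← ih]; simp only [hm.sum_snoc]

lemma snoc_le (hm : IsWordLaw m) {n : ℕ} (w : Fin n → S) (b : S) :
    m (n + 1) (wordSnoc w b) ≤ m n w := by
  rw [← hm.sum_snoc n w]
  exact Finset.single_le_sum (f := fun b => m (n + 1) (wordSnoc w b))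
    (fun _ _ => hm.nonneg _ _) (Finset.mem_univ b)

lemma cons_le (hm : IsWordLaw m) {n : ℕ} (a : S) (w : Fin n → S) :
    m (n + 1) (wordCons a w) ≤ m n w := by
  rw [← hm.sum_cons n w]
  exact Finset.single_le_sum (f := fun b => m (n + 1) (wordCons b w))
    (fun _ _ => hm.nonneg _ _) (Finset.mem_univ a)

lemma le_one (hm : IsWordLaw m) {n : ℕ} (w : Fin n → S) : m n w ≤ 1 := by
  rw [← hm.sum_eq_one n]
  exact Finset.single_le_sum (f := m n) (fun _ _ => hm.nonneg _ _) (Finset.mem_univ w)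

lemma wordEntropy_nonneg (hm : IsWordLaw m) (n : ℕ) : 0 ≤ wordEntropy m n :=
  Finset.sum_nonneg fun w _ => negMulLog_nonneg (hm.nonneg _ w) (hm.le_one w)

lemma wordEntropy_zero (hm : IsWordLaw m) : wordEntropy m 0 = 0 := by
  simp [wordEntropy, hm.nil]

/-- The increments of the word entropies decrease. -/
lemma wordEntropy_concave (hm : IsWordLaw m) (n : ℕ) :
    wordEntropy m (n + 2) + wordEntropy m n ≤ 2 * wordEntropy m (n + 1) := by
  let p : S × (Fin n → S) × S → ℝ := fun x => m (n + 2) (wordCons x.1 (wordSnoc x.2.1 x.2.2))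
  let r : S × (Fin n → S) × S → ℝ := fun x =>
    m (n + 1) (wordCons x.1 x.2.1) * m (n + 1) (wordSnoc x.2.1 x.2.2) / m n x.2.1
  have hp : ∀ x, 0 ≤ p x := fun x => hm.nonneg _ _
  have hr : ∀ x, 0 ≤ r x := fun x =>
    div_nonneg (mul_nonneg (hm.nonneg _ _) (hm.nonneg _ _)) (hm.nonneg _ _)
  have hpos : ∀ a (w : Fin n → S) b, m (n + 2) (wordCons a (wordSnoc w b)) ≠ 0 →
      0 < m (n + 1) (wordCons a w) ∧ 0 < m (n + 1) (wordSnoc w b) ∧ 0 < m n w := by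
    intro a w b h
    have h' : 0 < m (n + 2) (wordCons a (wordSnoc w b)) := lt_of_le_of_ne (hm.nonneg _ _) h.symm
    have h2 := h'.trans_le (hm.cons_le a (wordSnoc w b))
    refine ⟨?_, h2, h2.trans_le (hm.snoc_le w b)⟩
    rw [wordCons_wordSnoc] at h'
    exact h'.trans_le (hm.snoc_le _ b)
  have h0 : ∀ x, p x ≠ 0 → r x ≠ 0 := by
    rintro ⟨a, w, b⟩ h
    obtain ⟨h1, h2, h3⟩ := hpos a w b h
    exact (div_pos (mul_pos h1 h2) h3).ne'
  have hsp : ∑ x, p x = 1 := by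
    rw [← hm.sum_eq_one (n + 2), sum_words_cons, Fintype.sum_prod_type]
    refine Finset.sum_congr rfl fun a _ => ?_
    rw [sum_words_snoc, Fintype.sum_prod_type]
  have hsr : ∑ x, r x = 1 := by
    rw [← hm.sum_eq_one n, Fintype.sum_prod_type, Finset.sum_congr rfl fun a _ =>
      Fintype.sum_prod_type _, Finset.sum_comm]
    refine Finset.sum_congr rfl fun w _ => ?_
    simp only [r]
    simp_rw [← Finset.sum_div, ← Finset.mul_sum, hm.sum_snoc]
    rw [← Finset.sum_mul, hm.sum_cons]
    rcases eq_or_ne (m n w) 0 with h | h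
    · simp [h]
    · field_simp
  have hG := (gibbs_le hp hr h0 (by rw [hsp, hsr])).1
  have hE : ∑ x, p x * (log (r x) - log (p x)) =
      wordEntropy m (n + 2) - wordEntropy m (n + 1) - wordEntropy m (n + 1)
        + wordEntropy m n := by
    have hpt : ∀ x, p x * (log (r x) - log (p x)) =
        negMulLog (p x) + p x * log (m (n + 1) (wordCons x.1 x.2.1))
        + p x * log (m (n + 1) (wordSnoc x.2.1 x.2.2)) - p x * log (m n x.2.1) := by
      rintro ⟨a, w, b⟩
      rcases eq_or_ne (p (a, w, b)) 0 with h | h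
      · simp [h]
      · obtain ⟨h1, h2, h3⟩ := hpos a w b h
        simp only [r, negMulLog]
        rw [Real.log_div (mul_pos h1 h2).ne' h3.ne', Real.log_mul h1.ne' h2.ne']
        ring
    rw [Finset.sum_congr rfl fun x _ => hpt x, Finset.sum_sub_distrib, Finset.sum_add_distrib,
      Finset.sum_add_distrib]
    have e1 : ∑ x, negMulLog (p x) = wordEntropy m (n + 2) := by
      rw [wordEntropy, sum_words_cons, Fintype.sum_prod_type]
      refine Finset.sum_congr rfl fun a _ => ?_
      rw [sum_words_snoc, Fintype.sum_prod_type]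
    have e2 : ∑ x, p x * log (m (n + 1) (wordCons x.1 x.2.1)) = - wordEntropy m (n + 1) := by
      rw [wordEntropy, sum_words_cons, Fintype.sum_prod_type, ← Finset.sum_neg_distrib]
      refine Finset.sum_congr rfl fun a _ => ?_
      rw [Fintype.sum_prod_type, ← Finset.sum_neg_distrib]
      refine Finset.sum_congr rfl fun w _ => ?_
      simp only [p, wordCons_wordSnoc]
      rw [← Finset.sum_mul, hm.sum_snoc]
      simp [negMulLog]
    have e3 : ∑ x, p x * log (m (n + 1) (wordSnoc x.2.1 x.2.2)) = - wordEntropy m (n + 1) := by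
      rw [wordEntropy, sum_words_snoc, Fintype.sum_prod_type_right, Fintype.sum_prod_type,
        ← Finset.sum_neg_distrib]
      refine Finset.sum_congr rfl fun w _ => ?_
      rw [← Finset.sum_neg_distrib]
      refine Finset.sum_congr rfl fun b _ => ?_
      simp only [p]
      rw [← Finset.sum_mul, hm.sum_cons]
      simp [negMulLog]
    have e4 : ∑ x, p x * log (m n x.2.1) = - wordEntropy m n := by
      rw [wordEntropy, Fintype.sum_prod_type_right, Fintype.sum_prod_type,
        ← Finset.sum_neg_distrib]
      refine Finset.sum_congr rfl fun w _ => ?_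
      simp only [p]
      simp_rw [← Finset.sum_mul, hm.sum_cons]
      rw [hm.sum_snoc]
      simp [negMulLog]
    rw [e1, e2, e3, e4]
    ring
  rw [hE] at hG
  linarith

/-- The last two letters of a long word have the same distribution as a word of length two. -/
lemma sum_last_two (hm : IsWordLaw m) (F : S → S → ℝ) (n : ℕ) :
    ∑ w : Fin (n + 1) → S, ∑ b, m (n + 2) (wordSnoc w b) * F (w (Fin.last n)) b =
      ∑ i, ∑ j, m 2 (wordSnoc (fun _ => i) j) * F i j := by
  induction n with
  | zero => rw [sum_words_one]
  | succ n ih =>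
    rw [← ih, sum_words_cons, Finset.sum_comm]
    refine Finset.sum_congr rfl fun w _ => ?_
    rw [Finset.sum_comm]
    refine Finset.sum_congr rfl fun b _ => ?_
    simp only [← Fin.succ_last, wordCons_succ, ← wordCons_wordSnoc]
    rw [← Finset.sum_mul, hm.sum_cons]

end IsWordLaw

end WordLaw

lemma ciInf_eq_of_tendsto {f : ℕ → ℝ} {h : ℝ} (hle : ∀ n, h ≤ f n)
    (hf : Tendsto f atTop (nhds h)) : ⨅ n, f n = h := by
  refine le_antisymm (ge_of_tendsto' hf fun n => ciInf_le ⟨h, ?_⟩ n) (le_ciInf hle)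
  rintro _ ⟨n, rfl⟩
  exact hle n

lemma tendsto_add_mul_div (a h : ℝ) :
    Tendsto (fun n : ℕ => (a + n * h) / (n + 1)) atTop (nhds h) := by
  have : (fun n : ℕ => (a + n * h) / ((n : ℝ) + 1)) =
      fun n : ℕ => h + (a - h) * (1 / ((n : ℝ) + 1)) := by
    ext n
    have : (n : ℝ) + 1 ≠ 0 := by positivity
    field_simp
    ring
  rw [this]
  simpa using (tendsto_one_div_add_atTop_nhds_zero_nat (𝕜 := ℝ)).const_mul (a - h)
    |>.const_add h

section Flow

variable {S : Type*} [Fintype S]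

/-- A stationary probability flow on the edges of the complete graph on `S`. -/
structure IsFlow (q : S → S → ℝ) : Prop where
  nonneg : ∀ i j, 0 ≤ q i j
  sum_eq_one : ∑ i, ∑ j, q i j = 1
  balance : ∀ j, ∑ i, q i j = ∑ i, q j i

/-- The total flow through a vertex. -/
def outflow (q : S → S → ℝ) (i : S) : ℝ := ∑ j, q i j

/-- The word probabilities of the stationary Markov chain with flow `q`. -/
noncomputable def markovLaw (q : S → S → ℝ) : ∀ n : ℕ, (Fin n → S) → ℝ
  | 0, _ => 1
  | n + 1, w => outflow q (w 0) *
      ∏ i : Fin n, (q (w i.castSucc) (w i.succ) / outflow q (w i.castSucc))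

/-- The entropy rate of the stationary Markov chain with flow `q`. -/
noncomputable def entropyRate (q : S → S → ℝ) : ℝ :=
  ∑ i, ∑ j, negMulLog (q i j) - ∑ i, negMulLog (outflow q i)

variable {q : S → S → ℝ}

lemma markovLaw_snoc {n : ℕ} (w : Fin (n + 1) → S) (b : S) :
    markovLaw q (n + 2) (wordSnoc w b) =
      markovLaw q (n + 1) w * (q (w (Fin.last n)) b / outflow q (w (Fin.last n))) := by
  have h0 : wordSnoc w b 0 = w 0 := by
    rw [← Fin.castSucc_zero, wordSnoc_castSucc]
  simp only [markovLaw, Fin.prod_univ_castSucc (n := n), Fin.succ_castSucc, wordSnoc_castSucc,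
    Fin.succ_last, wordSnoc_last, h0, mul_assoc]

lemma markovLaw_one (a : S) : markovLaw q 1 (fun _ => a) = outflow q a := by
  simp [markovLaw]

namespace IsFlow

lemma outflow_nonneg (hq : IsFlow q) (i : S) : 0 ≤ outflow q i :=
  Finset.sum_nonneg fun j _ => hq.nonneg i j

lemma le_outflow (hq : IsFlow q) (i j : S) : q i j ≤ outflow q i :=
  Finset.single_le_sum (f := q i) (fun j _ => hq.nonneg i j) (Finset.mem_univ j)

lemma le_outflow_right (hq : IsFlow q) (i j : S) : q i j ≤ outflow q j := by
  rw [outflow, ← hq.balance]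
  exact Finset.single_le_sum (f := fun i => q i j) (fun i _ => hq.nonneg i j) (Finset.mem_univ i)

lemma eq_zero (hq : IsFlow q) {i : S} (h : outflow q i = 0) (j : S) : q i j = 0 :=
  le_antisymm (h ▸ hq.le_outflow i j) (hq.nonneg i j)

lemma outflow_mul_div (hq : IsFlow q) (i j : S) : outflow q i * (q i j / outflow q i) = q i j := by
  rcases eq_or_ne (outflow q i) 0 with h | h
  · rw [hq.eq_zero h]; simp
  · field_simp

lemma markovLaw_two (hq : IsFlow q) (a b : S) :
    markovLaw q 2 (wordSnoc (fun _ => a) b) = q a b := by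
  rw [markovLaw_snoc, markovLaw_one, hq.outflow_mul_div]

lemma markovLaw_nonneg (hq : IsFlow q) : ∀ n w, 0 ≤ markovLaw q n w
  | 0, _ => zero_le_one
  | _ + 1, _ => mul_nonneg (hq.outflow_nonneg _) (Finset.prod_nonneg fun _ _ =>
      div_nonneg (hq.nonneg _ _) (hq.outflow_nonneg _))

lemma markovLaw_le_outflow (hq : IsFlow q) :
    ∀ n (w : Fin (n + 1) → S) i, markovLaw q (n + 1) w ≤ outflow q (w i) := by
  intro n
  induction n with
  | zero =>
    intro w i
    rw [Fin.fin_one_eq_zero i]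
    simp [markovLaw]
  | succ n ih =>
    intro w i
    obtain ⟨v, b, rfl⟩ := exists_eq_wordSnoc w
    rw [markovLaw_snoc]
    have hP : 0 ≤ q (v (Fin.last n)) b / outflow q (v (Fin.last n)) :=
      div_nonneg (hq.nonneg _ _) (hq.outflow_nonneg _)
    induction i using Fin.lastCases with
    | last =>
      rw [wordSnoc_last]
      calc _ ≤ outflow q (v (Fin.last n)) *
              (q (v (Fin.last n)) b / outflow q (v (Fin.last n))) :=
            mul_le_mul_of_nonneg_right (ih v _) hP
        _ = q (v (Fin.last n)) b := hq.outflow_mul_div _ _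
        _ ≤ _ := hq.le_outflow_right _ _
    | cast i =>
      rw [wordSnoc_castSucc]
      refine (mul_le_of_le_one_right (hq.markovLaw_nonneg _ _) ?_).trans (ih v i)
      exact div_le_one_of_le₀ (hq.le_outflow _ _) (hq.outflow_nonneg _)

lemma isWordLaw (hq : IsFlow q) : IsWordLaw (markovLaw q) where
  nonneg := hq.markovLaw_nonneg
  nil _ := rfl
  sum_snoc n w := by
    cases n with
    | zero =>
      have : ∀ b, wordSnoc w b = fun _ => b := by
        intro b
        ext i
        rw [Fin.fin_one_eq_zero i]
        exact wordSnoc_last w b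
      simp only [this]
      exact (Finset.sum_congr rfl fun b _ => markovLaw_one b).trans hq.sum_eq_one
    | succ n =>
      simp only [markovLaw_snoc]
      rw [← Finset.mul_sum, ← Finset.sum_div]
      rcases eq_or_ne (outflow q (w (Fin.last n))) 0 with h | h
      · have : markovLaw q (n + 1) w = 0 :=
          le_antisymm (h ▸ hq.markovLaw_le_outflow n w _) (hq.markovLaw_nonneg _ _)
        simp [this]
      · rw [← outflow, div_self h, mul_one]
  sum_cons n w := by
    cases n with
    | zero =>
      have : ∀ b, wordCons b w = fun _ => b := by
        intro b
        ext i
        rw [Fin.fin_one_eq_zero i]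
        exact wordCons_zero b w
      simp only [this]
      exact (Finset.sum_congr rfl fun b _ => markovLaw_one b).trans hq.sum_eq_one
    | succ n =>
      simp only [markovLaw]
      simp only [Fin.prod_univ_succ (n := n), wordCons_zero, wordCons_succ, Fin.castSucc_zero,
        ← Fin.succ_castSucc, ← mul_assoc]
      simp only [hq.outflow_mul_div, ← Finset.sum_mul]
      rw [hq.balance, ← outflow]

end IsFlow

lemma IsWordLaw.sum_mul_log_markovLaw {m : ∀ n : ℕ, (Fin n → S) → ℝ} (hm : IsWordLaw m)
    (hac : ∀ n w, m n w ≠ 0 → markovLaw q n w ≠ 0) (n : ℕ) :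
    ∑ w : Fin (n + 1) → S, m (n + 1) w * log (markovLaw q (n + 1) w) =
      ∑ i, m 1 (fun _ => i) * log (outflow q i) +
        n * ∑ i, ∑ j, m 2 (wordSnoc (fun _ => i) j) * log (q i j / outflow q i) := by
  induction n with
  | zero =>
    rw [sum_words_one]
    simp [markovLaw_one]
  | succ n ih =>
    have h : ∀ (w : Fin (n + 1) → S) b,
        m (n + 2) (wordSnoc w b) * log (markovLaw q (n + 2) (wordSnoc w b)) =
        m (n + 2) (wordSnoc w b) * log (markovLaw q (n + 1) w) + m (n + 2) (wordSnoc w b) *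
          log (q (w (Fin.last n)) b / outflow q (w (Fin.last n))) := by
      intro w b
      rcases eq_or_ne (m (n + 2) (wordSnoc w b)) 0 with h | h
      · simp [h]
      · have h' := hac _ _ h
        rw [markovLaw_snoc] at h' ⊢
        rw [Real.log_mul (left_ne_zero_of_mul h') (right_ne_zero_of_mul h'), mul_add]
    rw [sum_words_snoc]
    simp only [h, Finset.sum_add_distrib]
    rw [hm.sum_last_two (fun i j => log (q i j / outflow q i))]
    simp only [← Finset.sum_mul, hm.sum_snoc]
    rw [ih]
    push_cast
    ring

namespace IsFlow

lemma entropyRate_eq (hq : IsFlow q) :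
    entropyRate q = - ∑ i, ∑ j, q i j * log (q i j / outflow q i) := by
  rw [entropyRate, ← Finset.sum_sub_distrib, ← Finset.sum_neg_distrib]
  refine Finset.sum_congr rfl fun i _ => ?_
  have : ∀ j, q i j * log (q i j / outflow q i) =
      q i j * log (q i j) - q i j * log (outflow q i) := by
    intro j
    rcases eq_or_ne (q i j) 0 with h | h
    · simp [h]
    · rw [Real.log_div h fun h' => h (hq.eq_zero h' j), mul_sub]
  simp only [this, Finset.sum_sub_distrib, ← Finset.sum_mul, negMulLog, neg_mul,
    Finset.sum_neg_distrib]
  rw [← outflow]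
  ring

lemma wordEntropy_markovLaw (hq : IsFlow q) (n : ℕ) :
    wordEntropy (markovLaw q) (n + 1) = wordEntropy (markovLaw q) 1 + n * entropyRate q := by
  have h := hq.isWordLaw.sum_mul_log_markovLaw (fun _ _ h => h) n
  simp only [markovLaw_one, hq.markovLaw_two] at h
  rw [hq.entropyRate_eq, wordEntropy, wordEntropy, sum_words_one]
  simp only [negMulLog, neg_mul, Finset.sum_neg_distrib, markovLaw_one]
  rw [h]
  ring

lemma entropyRate_le (hq : IsFlow q) : entropyRate q ≤ wordEntropy (markovLaw q) 1 := by
  have h := hq.isWordLaw.wordEntropy_concave 0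
  have h1 := hq.wordEntropy_markovLaw 1
  rw [hq.isWordLaw.wordEntropy_zero] at h
  norm_num at h h1
  linarith

lemma le_wordEntropy (hq : IsFlow q) (n : ℕ) :
    (n + 1) * entropyRate q ≤ wordEntropy (markovLaw q) (n + 1) := by
  rw [hq.wordEntropy_markovLaw]
  linarith [hq.entropyRate_le]

lemma iInf_wordEntropy (hq : IsFlow q) :
    ⨅ n : ℕ, wordEntropy (markovLaw q) (n + 1) / (n + 1) = entropyRate q := by
  refine ciInf_eq_of_tendsto (fun n => ?_) ?_
  · rw [le_div_iff₀ (by positivity), mul_comm]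
    exact hq.le_wordEntropy n
  · exact (tendsto_add_mul_div _ _).congr fun n => by rw [hq.wordEntropy_markovLaw n]

/-- A connected flow has only one stationary distribution. -/
lemma stationary_unique (hq : IsFlow q) (hpos : ∀ i, 0 < outflow q i)
    (hconn : ∀ g : S → ℝ, (∀ i j, q i j ≠ 0 → g i = g j) → ∀ i j, g i = g j)
    {ρ : S → ℝ} (hsum : ∑ i, ρ i = 1) (hρ : ∀ j, ∑ i, ρ i * (q i j / outflow q i) = ρ j) (i : S) :
    ρ i = outflow q i := by
  set g : S → ℝ := fun i => ρ i / outflow q i with hg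
  have hρg : ∀ j, ρ j = outflow q j * g j := by
    intro j
    have := (hpos j).ne'
    simp only [hg]
    field_simp
  have h0 : ∑ i, ∑ j, q i j * (g i - g j) ^ 2 = 0 := by
    have e : ∀ i j, q i j * (g i - g j) ^ 2 =
        q i j * g i ^ 2 + q i j * g j ^ 2 - 2 * (g j * (ρ i * (q i j / outflow q i))) := by
      intro i j
      have := (hpos i).ne'
      simp only [hg]
      field_simp
      ring
    simp only [e, Finset.sum_sub_distrib, Finset.sum_add_distrib]
    rw [Finset.sum_comm (f := fun i j => q i j * g j ^ 2),
      Finset.sum_comm (f := fun i j => 2 * (g j * (ρ i * (q i j / outflow q i))))]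
    simp only [← Finset.sum_mul, ← Finset.mul_sum, hρ, hq.balance]
    have hout : ∀ i, ∑ j, q i j = outflow q i := fun _ => rfl
    simp only [hout, hρg]
    rw [Finset.mul_sum, ← Finset.sum_add_distrib, ← Finset.sum_sub_distrib]
    refine Finset.sum_eq_zero fun i _ => ?_
    ring
  have hc : ∀ i j, g i = g j := by
    refine hconn g fun i j hij => ?_
    have hnn : ∀ i j, 0 ≤ q i j * (g i - g j) ^ 2 := fun i j =>
      mul_nonneg (hq.nonneg i j) (sq_nonneg _)
    have h1 := (Finset.sum_eq_zero_iff_of_nonneg fun i _ =>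
      Finset.sum_nonneg fun j _ => hnn i j).1 h0 i (Finset.mem_univ i)
    have h2 := (Finset.sum_eq_zero_iff_of_nonneg fun j _ => hnn i j).1 h1 j (Finset.mem_univ j)
    have h3 := (mul_eq_zero.1 h2).resolve_left hij
    exact sub_eq_zero.1 (pow_eq_zero_iff (two_ne_zero) |>.1 h3)
  have h1 : g i = 1 := by
    have : ∑ j, outflow q j * g i = 1 := by
      rw [← hsum]
      exact Finset.sum_congr rfl fun j _ => by rw [hρg j, hc i j]
    rw [← Finset.sum_mul] at this
    simp only [outflow] at this
    rw [hq.sum_eq_one, one_mul] at this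
    exact this
  rw [hρg, h1, mul_one]

end IsFlow

/-- A stationary process whose words have bounded relative entropy with respect to a
connected Markov chain is that Markov chain. -/
lemma IsWordLaw.eq_markovLaw {m : ∀ n : ℕ, (Fin n → S) → ℝ} (hm : IsWordLaw m) (hq : IsFlow q)
    (hpos : ∀ i, 0 < outflow q i)
    (hconn : ∀ g : S → ℝ, (∀ i j, q i j ≠ 0 → g i = g j) → ∀ i j, g i = g j)
    (hac : ∀ i j, m 2 (wordSnoc (fun _ => i) j) ≠ 0 → q i j ≠ 0) {c K : ℝ}
    (hc : ∑ i, ∑ j, m 2 (wordSnoc (fun _ => i) j) * log (q i j / outflow q i) = -c)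
    (hK : ∀ n : ℕ, n * c - wordEntropy m (n + 1) ≤ K) (n : ℕ) (w : Fin n → S) :
    m n w = markovLaw q n w := by
  have hsum1 : ∀ i, ∑ j, q i j / outflow q i = 1 := by
    intro i
    rw [← Finset.sum_div, ← outflow, div_self (hpos i).ne']
  have hac' : ∀ n (w : Fin (n + 1) → S) b, m (n + 2) (wordSnoc w b) ≠ 0 →
      q (w (Fin.last n)) b ≠ 0 := by
    intro n
    induction n with
    | zero =>
      intro w b h
      obtain ⟨a, rfl⟩ : ∃ a, w = fun _ => a :=
        ⟨w 0, funext fun i => by rw [Fin.fin_one_eq_zero i]⟩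
      exact hac _ _ h
    | succ n ih =>
      intro w b h
      obtain ⟨a, v, rfl⟩ : ∃ a v, w = wordCons a v := ⟨w 0, Fin.tail w, (Fin.cons_self_tail w).symm⟩
      rw [← Fin.succ_last, wordCons_succ]
      refine ih v b fun h' => h (le_antisymm ?_ (hm.nonneg _ _))
      rw [← wordCons_wordSnoc, ← h']
      exact hm.cons_le _ _
  -- one step of the chain rule
  have hstep : ∀ n, c - (wordEntropy m (n + 2) - wordEntropy m (n + 1)) ≥ 0 ∧
      (c - (wordEntropy m (n + 2) - wordEntropy m (n + 1)) = 0 →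
        ∀ (w : Fin (n + 1) → S) b, m (n + 2) (wordSnoc w b) =
          m (n + 1) w * (q (w (Fin.last n)) b / outflow q (w (Fin.last n)))) := by
    intro n
    let p : (Fin (n + 1) → S) × S → ℝ := fun x => m (n + 2) (wordSnoc x.1 x.2)
    let r : (Fin (n + 1) → S) × S → ℝ := fun x =>
      m (n + 1) x.1 * (q (x.1 (Fin.last n)) x.2 / outflow q (x.1 (Fin.last n)))
    have hmpos : ∀ (w : Fin (n + 1) → S) b, m (n + 2) (wordSnoc w b) ≠ 0 → m (n + 1) w ≠ 0 := by
      intro w b h h'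
      exact h (le_antisymm (h' ▸ hm.snoc_le w b) (hm.nonneg _ _))
    have hPpos : ∀ (w : Fin (n + 1) → S) b, m (n + 2) (wordSnoc w b) ≠ 0 →
        q (w (Fin.last n)) b / outflow q (w (Fin.last n)) ≠ 0 := fun w b h =>
      div_ne_zero (hac' n w b h) (hpos _).ne'
    have hG := gibbs_le (p := p) (r := r) (fun x => hm.nonneg _ _)
      (fun x => mul_nonneg (hm.nonneg _ _) (div_nonneg (hq.nonneg _ _) (hpos _).le))
      (fun x h => mul_ne_zero (hmpos _ _ h) (hPpos _ _ h))
      (by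
        simp only [Fintype.sum_prod_type, p, r, ← Finset.mul_sum, hsum1, hm.sum_snoc, mul_one,
          le_refl])
    have hE : ∑ x, p x * (log (r x) - log (p x)) =
        - (c - (wordEntropy m (n + 2) - wordEntropy m (n + 1))) := by
      have hpt : ∀ x, p x * (log (r x) - log (p x)) = negMulLog (p x) + p x * log (m (n + 1) x.1)
          + p x * log (q (x.1 (Fin.last n)) x.2 / outflow q (x.1 (Fin.last n))) := by
        rintro ⟨w, b⟩
        rcases eq_or_ne (p (w, b)) 0 with h | h
        · simp [h]
        · simp only [r, negMulLog]
          rw [Real.log_mul (hmpos w b h) (hPpos w b h)]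
          ring
      simp only [hpt, Finset.sum_add_distrib, Fintype.sum_prod_type, p]
      rw [hm.sum_last_two (fun i j => log (q i j / outflow q i)), hc, ← sum_words_snoc
        (F := fun w => negMulLog (m (n + 2) w)), ← wordEntropy]
      simp only [← Finset.sum_mul, hm.sum_snoc]
      simp only [wordEntropy, negMulLog, neg_mul, Finset.sum_neg_distrib]
      ring
    rw [hE] at hG
    refine ⟨by linarith [hG.1], fun h w b => hG.2 (by rw [h, neg_zero]) (w, b)⟩
  set d : ℕ → ℝ := fun n => c - (wordEntropy m (n + 2) - wordEntropy m (n + 1)) with hd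
  have hmono : Monotone d := monotone_nat_of_le_succ fun n => by
    have := hm.wordEntropy_concave (n + 1)
    simp only [hd]
    linarith
  have htel : ∀ n, ∑ i ∈ Finset.range n, d i = n * c - wordEntropy m (n + 1) + wordEntropy m 1 := by
    intro n
    induction n with
    | zero => simp
    | succ n ih =>
      rw [Finset.sum_range_succ, ih]
      simp only [hd]
      push_cast
      ring
  have hd0 : ∀ n, d n = 0 := by
    intro n
    by_contra hne
    have hdn : 0 < d n := lt_of_le_of_ne (hstep n).1 (Ne.symm hne)
    obtain ⟨N, hN⟩ := exists_nat_gt ((K + wordEntropy m 1) / d n)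
    rw [div_lt_iff₀ hdn] at hN
    have h1 : N * d n ≤ ∑ i ∈ Finset.range (n + N), d i := by
      rw [Finset.sum_range_add]
      have h2 : ∑ i ∈ Finset.range N, d n ≤ ∑ i ∈ Finset.range N, d (n + i) :=
        Finset.sum_le_sum fun i _ => hmono (Nat.le_add_right n i)
      have h3 : 0 ≤ ∑ i ∈ Finset.range n, d i := Finset.sum_nonneg fun i _ => (hstep i).1
      simp only [Finset.sum_const, Finset.card_range, nsmul_eq_mul] at h2
      linarith
    rw [htel] at h1
    linarith [hK (n + N)]
  have hchain : ∀ n (w : Fin (n + 1) → S) b, m (n + 2) (wordSnoc w b) =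
      m (n + 1) w * (q (w (Fin.last n)) b / outflow q (w (Fin.last n))) :=
    fun n => (hstep n).2 (hd0 n)
  have hone : ∀ i, m 1 (fun _ => i) = outflow q i := by
    refine hq.stationary_unique hpos hconn ?_ fun j => ?_
    · rw [← sum_words_one, hm.sum_eq_one]
    · rw [← hm.sum_cons]
      refine Finset.sum_congr rfl fun i _ => ?_
      rw [← hchain 0]
      congr 1
      ext l
      fin_cases l <;> rfl
  cases n with
  | zero => rw [hm.nil]; rfl
  | succ n =>
    induction n with
    | zero =>
      have : w = fun _ => w 0 := by
        ext i
        rw [Fin.fin_one_eq_zero i]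
      rw [this, hone, markovLaw_one]
    | succ n ih =>
      obtain ⟨v, b, rfl⟩ := exists_eq_wordSnoc w
      rw [hchain, markovLaw_snoc, ih]

end Flow

/-- A stationary process dominated by a connected Markov chain is that Markov chain. -/
lemma IsWordLaw.eq_markovLaw_of_le {S : Type*} [Fintype S] {q : S → S → ℝ}
    {m : ∀ n : ℕ, (Fin n → S) → ℝ} (hm : IsWordLaw m) (hq : IsFlow q)
    (hpos : ∀ i, 0 < outflow q i)
    (hconn : ∀ g : S → ℝ, (∀ i j, q i j ≠ 0 → g i = g j) → ∀ i j, g i = g j) {K : ℝ}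
    (hle : ∀ n w, m n w ≤ K * markovLaw q n w) (n : ℕ) (w : Fin n → S) :
    m n w = markovLaw q n w := by
  have hK : 0 < K := by
    have := hle 0 Fin.elim0
    rw [hm.nil, hq.isWordLaw.nil] at this
    linarith
  have hac : ∀ n w, m n w ≠ 0 → markovLaw q n w ≠ 0 := by
    intro n w h h'
    have := hle n w
    rw [h', mul_zero] at this
    exact h (le_antisymm this (hm.nonneg _ _))
  refine hm.eq_markovLaw (K := log K) hq hpos hconn (fun i j h => ?_) (neg_neg _).symm
    (fun n => ?_) n w
  · rw [← hq.markovLaw_two]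
    exact hac _ _ h
  · have h1 := hm.sum_mul_log_markovLaw hac n
    have h2 : ∑ i, m 1 (fun _ => i) * log (outflow q i) ≤ 0 := by
      refine Finset.sum_nonpos fun i _ => mul_nonpos_of_nonneg_of_nonpos (hm.nonneg _ _) ?_
      refine Real.log_nonpos (hpos i).le ?_
      rw [← markovLaw_one]
      exact hq.isWordLaw.le_one _
    have h3 : ∑ w : Fin (n + 1) → S, negMulLog (m (n + 1) w) +
        ∑ w : Fin (n + 1) → S, m (n + 1) w * log (markovLaw q (n + 1) w) +
        ∑ w : Fin (n + 1) → S, m (n + 1) w * log K ≥ 0 := by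
      rw [← Finset.sum_add_distrib, ← Finset.sum_add_distrib]
      refine Finset.sum_nonneg fun w _ => ?_
      rcases eq_or_ne (m (n + 1) w) 0 with h | h
      · simp [h]
      · have hmp : 0 < m (n + 1) w := lt_of_le_of_ne (hm.nonneg _ _) h.symm
        have := Real.log_le_log hmp (hle _ w)
        rw [Real.log_mul hK.ne' (hac _ _ h)] at this
        have := mul_le_mul_of_nonneg_left this hmp.le
        rw [negMulLog]
        linarith
    rw [← Finset.sum_mul, hm.sum_eq_one, one_mul, ← wordEntropy] at h3
    linarith

section ShiftSpace

variable {k : ℕ}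

/-- The set of sequences that read the word `w` from position `a` on. -/
def wordCylinder (a : ℤ) {n : ℕ} (w : Fin n → Fin k) : Set (ℤ → Fin k) :=
  {x | ∀ p : Fin n, x (a + ((p : ℕ) : ℤ)) = w p}

/-- The probabilities of the words read from position `0` on. -/
noncomputable def wordLaw (μ : Measure (ℤ → Fin k)) (n : ℕ) (w : Fin n → Fin k) : ℝ :=
  (μ {x | ∀ p : Fin n, x ((p : ℕ) : ℤ) = w p}).toReal

/-- The words read from any position of a `μ`-random sequence have probabilities `m`. -/
def HasWordLaw (μ : Measure (ℤ → Fin k)) (m : ∀ n : ℕ, (Fin n → Fin k) → ℝ) : Prop :=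
  ∀ (a : ℤ) (n : ℕ) (w : Fin n → Fin k), (μ (wordCylinder a w)).toReal = m n w

lemma wordCylinder_zero {n : ℕ} (w : Fin n → Fin k) :
    wordCylinder 0 w = {x | ∀ p : Fin n, x ((p : ℕ) : ℤ) = w p} := by
  simp [wordCylinder]

lemma HasWordLaw.wordLaw_eq {μ : Measure (ℤ → Fin k)} {m : ∀ n : ℕ, (Fin n → Fin k) → ℝ}
    (h : HasWordLaw μ m) : wordLaw μ = m := by
  funext n w
  rw [wordLaw, ← wordCylinder_zero, h]

lemma isClopen_wordCylinder (a : ℤ) {n : ℕ} (w : Fin n → Fin k) : IsClopen (wordCylinder a w) := by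
  have : wordCylinder a w =
      ⋂ p : Fin n, (fun x : ℤ → Fin k => x (a + ((p : ℕ) : ℤ))) ⁻¹' {w p} := by
    ext x
    simp [wordCylinder]
  rw [this]
  exact isClopen_iInter_of_finite fun p => (isClopen_discrete _).preimage (continuous_apply _)

lemma measurableSet_wordCylinder (a : ℤ) {n : ℕ} (w : Fin n → Fin k) :
    MeasurableSet (wordCylinder a w) :=
  (isClopen_wordCylinder a w).1.measurableSet

lemma mem_wordCylinder_of_eq {a : ℤ} {n : ℕ} {w : Fin n → Fin k} {x y : ℤ → Fin k}
    (hx : x ∈ wordCylinder a w) (h : ∀ i, a ≤ i → i < a + n → y i = x i) :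
    y ∈ wordCylinder a w := by
  intro p
  rw [h _ (by omega) (by omega)]
  exact hx p

lemma eq_of_mem_wordCylinder {a : ℤ} {n : ℕ} {w : Fin n → Fin k} {x y : ℤ → Fin k}
    (hx : x ∈ wordCylinder a w) (hy : y ∈ wordCylinder a w) {i : ℤ} (h1 : a ≤ i)
    (h2 : i < a + n) : y i = x i := by
  have hi : i = a + (((⟨(i - a).toNat, by omega⟩ : Fin n) : ℕ) : ℤ) := by
    simp only
    omega
  rw [hi, hx, hy]

lemma HasWordLaw.ext {μ ν : Measure (ℤ → Fin k)} [IsProbabilityMeasure μ] [IsProbabilityMeasure ν]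
    {m : ∀ n : ℕ, (Fin n → Fin k) → ℝ} (hμ : HasWordLaw μ m) (hν : HasWordLaw ν m) : μ = ν := by
  set C : Set (Set (ℤ → Fin k)) :=
    {s | ∃ (N : ℕ) (w : Fin (2 * N + 1) → Fin k), s = wordCylinder (-(N : ℤ)) w} with hC
  refine ext_of_generate_finite C (le_antisymm ?_ ?_) ?_ ?_ (by simp)
  · refine iSup_le fun i => measurable_iff_comap_le.1 ?_
    refine @measurable_to_countable' _ _ _ _ (MeasurableSpace.generateFrom C) _ fun b => ?_
    have : (fun x : ℤ → Fin k => x i) ⁻¹' {b} = ⋃ w ∈ {w : Fin (2 * i.natAbs + 1) → Fin k |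
        wordCylinder (-(i.natAbs : ℤ)) w ⊆ (fun x : ℤ → Fin k => x i) ⁻¹' {b}},
        wordCylinder (-(i.natAbs : ℤ)) w := by
      refine Subset.antisymm (fun x hx => ?_) (iUnion₂_subset fun w hw => hw)
      have hxm : x ∈ wordCylinder (-(i.natAbs : ℤ))
          (fun p : Fin (2 * i.natAbs + 1) => x (-(i.natAbs : ℤ) + ((p : ℕ) : ℤ))) := fun p => rfl
      refine mem_iUnion₂.2 ⟨_, fun y hy => ?_, hxm⟩
      rw [mem_preimage, mem_singleton_iff] at hx ⊢
      rw [← hx]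
      exact eq_of_mem_wordCylinder hxm hy (by omega) (by omega)
    rw [this]
    exact MeasurableSet.biUnion (to_countable _) fun w _ =>
      MeasurableSpace.measurableSet_generateFrom ⟨_, w, rfl⟩
  · refine MeasurableSpace.generateFrom_le ?_
    rintro _ ⟨N, w, rfl⟩
    exact measurableSet_wordCylinder _ _
  · have key : ∀ N M : ℕ, N ≤ M → ∀ (w : Fin (2 * N + 1) → Fin k) (v : Fin (2 * M + 1) → Fin k),
        (wordCylinder (-(N : ℤ)) w ∩ wordCylinder (-(M : ℤ)) v).Nonempty →
        wordCylinder (-(M : ℤ)) v ⊆ wordCylinder (-(N : ℤ)) w := by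
      rintro N M hNM w v ⟨x, hxw, hxv⟩ y hy
      refine mem_wordCylinder_of_eq hxw fun i h1 h2 => ?_
      push_cast at h2
      exact eq_of_mem_wordCylinder hxv hy (by omega) (by push_cast; omega)
    rintro _ ⟨N, w, rfl⟩ _ ⟨M, v, rfl⟩ hne
    rcases le_total N M with h | h
    · rw [inter_eq_right.2 (key N M h w v hne)]
      exact ⟨M, v, rfl⟩
    · rw [inter_comm] at hne
      rw [inter_eq_left.2 (key M N h v w hne)]
      exact ⟨N, w, rfl⟩
  · rintro _ ⟨N, w, rfl⟩
    rw [← ENNReal.toReal_eq_toReal_iff' (measure_ne_top _ _) (measure_ne_top _ _), hμ, hν]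

lemma continuous_shiftMap : Continuous (shiftMap : (ℤ → Fin k) → ℤ → Fin k) :=
  continuous_pi fun i => continuous_apply (i + 1)

lemma shiftMap_preimage_wordCylinder (a : ℤ) {n : ℕ} (w : Fin n → Fin k) :
    shiftMap ⁻¹' wordCylinder a w = wordCylinder (a + 1) w := by
  ext x
  simp only [wordCylinder, shiftMap, mem_preimage, mem_ofPred_eq, add_right_comm]

lemma HasWordLaw.measurePreserving {μ : Measure (ℤ → Fin k)} [IsProbabilityMeasure μ]
    {m : ∀ n : ℕ, (Fin n → Fin k) → ℝ} (hμ : HasWordLaw μ m) :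
    MeasurePreserving shiftMap μ μ := by
  have hmeas := (continuous_shiftMap (k := k)).measurable
  refine ⟨hmeas, ?_⟩
  have := Measure.isProbabilityMeasure_map (μ := μ) hmeas.aemeasurable
  refine HasWordLaw.ext (m := m) (fun a n w => ?_) hμ
  rw [Measure.map_apply hmeas (measurableSet_wordCylinder a w), shiftMap_preimage_wordCylinder, hμ]

lemma hasWordLaw_wordLaw {μ : Measure (ℤ → Fin k)} (hμ : MeasurePreserving shiftMap μ μ) :
    HasWordLaw μ (wordLaw μ) := by
  intro a n w
  rw [wordLaw, ← wordCylinder_zero]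
  have h : ∀ a : ℤ, μ (wordCylinder (a + 1) w) = μ (wordCylinder a w) := fun a => by
    rw [← shiftMap_preimage_wordCylinder,
      hμ.measure_preimage (measurableSet_wordCylinder a w).nullMeasurableSet]
  congr 1
  induction a using Int.induction_on with
  | zero => rfl
  | succ i ih => rw [h, ih]
  | pred i ih => rw [← ih, ← h, sub_add_cancel]

lemma isWordLaw_wordLaw {μ : Measure (ℤ → Fin k)} [IsProbabilityMeasure μ]
    (hμ : MeasurePreserving shiftMap μ μ) : IsWordLaw (wordLaw μ) where
  nonneg _ _ := ENNReal.toReal_nonneg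
  nil w := by simp [wordLaw]
  sum_snoc n w := by
    have hμ' := hasWordLaw_wordLaw hμ
    simp only [← hμ' 0]
    have hU : wordCylinder 0 w = ⋃ b, wordCylinder 0 (wordSnoc w b) := by
      ext x
      simp [wordCylinder, Fin.forall_fin_succ']
    rw [hU, measure_iUnion _ fun b => measurableSet_wordCylinder _ _, tsum_fintype,
      ENNReal.toReal_sum fun _ _ => measure_ne_top _ _]
    intro b c hbc
    refine disjoint_left.2 fun x hx hy => hbc ?_
    have h1 := hx (Fin.last n)
    have h2 := hy (Fin.last n)
    rw [wordSnoc_last] at h1 h2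
    exact h1.symm.trans h2
  sum_cons n w := by
    have hμ' := hasWordLaw_wordLaw hμ
    simp only [← hμ' 0]
    rw [hμ' 0, ← hμ' 1]
    have hU : wordCylinder 1 w = ⋃ b, wordCylinder 0 (wordCons b w) := by
      ext x
      simp [wordCylinder, Fin.forall_fin_succ, add_comm]
    rw [hU, measure_iUnion _ fun b => measurableSet_wordCylinder _ _, tsum_fintype,
      ENNReal.toReal_sum fun _ _ => measure_ne_top _ _]
    intro b c hbc
    refine disjoint_left.2 fun x hx hy => hbc ?_
    have h1 := hx 0
    have h2 := hy 0
    rw [wordCons_zero] at h1 h2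
    exact h1.symm.trans h2

lemma HasWordLaw.of_tendsto {ι : Type*} {L : Filter ι} [L.NeBot]
    {μs : ι → ProbabilityMeasure (ℤ → Fin k)} {μ : ProbabilityMeasure (ℤ → Fin k)}
    {m : ∀ n : ℕ, (Fin n → Fin k) → ℝ} (hμ : Tendsto μs L (nhds μ))
    (h : ∀ (a : ℤ) n (w : Fin n → Fin k), Tendsto
      (fun i => ((μs i : Measure (ℤ → Fin k)) (wordCylinder a w)).toReal) L (nhds (m n w))) :
    HasWordLaw (μ : Measure (ℤ → Fin k)) m := by
  intro a n w
  refine tendsto_nhds_unique ?_ (h a n w)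
  exact (NNReal.continuous_coe.tendsto _).comp
    (ProbabilityMeasure.tendsto_measure_of_isClopen_of_tendsto hμ (isClopen_wordCylinder a w))

/-- Convergence of word probabilities implies weak convergence. -/
lemma tendsto_of_hasWordLaw {ι : Type*} {L : Filter ι}
    {μs : ι → ProbabilityMeasure (ℤ → Fin k)} {μ : ProbabilityMeasure (ℤ → Fin k)}
    {ms : ι → ∀ n : ℕ, (Fin n → Fin k) → ℝ} {m : ∀ n : ℕ, (Fin n → Fin k) → ℝ}
    (hμs : ∀ᶠ i in L, HasWordLaw (μs i : Measure (ℤ → Fin k)) (ms i))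
    (hμ : HasWordLaw (μ : Measure (ℤ → Fin k)) m)
    (h : ∀ n (w : Fin n → Fin k), Tendsto (fun i => ms i n w) L (nhds (m n w))) :
    Tendsto μs L (nhds μ) := by
  rw [tendsto_iff_ultrafilter]
  intro U hU
  obtain ⟨μ', hlim⟩ : ∃ μ', Tendsto μs U (nhds μ') := ⟨_, (U.map μs).le_nhds_lim⟩
  have hlaw : HasWordLaw (μ' : Measure (ℤ → Fin k)) m := by
    refine HasWordLaw.of_tendsto hlim fun a n w => ?_
    refine ((h n w).mono_left hU).congr' ?_
    filter_upwards [hU hμs] with i hi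
    exact (hi a n w).symm
  have heq : (μ' : Measure (ℤ → Fin k)) = μ := hlaw.ext hμ
  rwa [Subtype.ext heq] at hlim

lemma IsWordLaw.sum_window {S : Type*} [Fintype S] [DecidableEq S]
    {m : ∀ n : ℕ, (Fin n → S) → ℝ} (hm : IsWordLaw m) {n : ℕ} (v : Fin n → S) :
    ∀ (l s : ℕ) (h : s + n ≤ l),
      ∑ w : Fin l → S, (if ∀ p : Fin n, w ⟨s + p, by omega⟩ = v p then m l w else 0) = m n v := by
  intro l
  induction l with
  | zero =>
    intro s h
    obtain rfl : n = 0 := by omega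
    rw [sum_words_zero _ v, if_pos fun p => p.elim0]
  | succ l ih =>
    intro s h
    rcases Nat.lt_or_ge l (s + n) with hl | hl
    · rcases s with _ | s
      · obtain rfl : n = l + 1 := by omega
        rw [Finset.sum_eq_single v]
        · rw [if_pos]
          intro p
          congr 1
          ext
          simp
        · intro w _ hw
          rw [if_neg]
          intro h'
          refine hw (funext fun p => ?_)
          rw [← h' p]
          congr 1
          ext
          simp
        · simp
      · rw [sum_words_cons, Finset.sum_comm, ← ih s (by omega)]
        refine Finset.sum_congr rfl fun w _ => ?_
        have e : ∀ (a : S) (p : Fin n), wordCons a w ⟨s + 1 + p, by omega⟩ =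
            w ⟨s + p, by omega⟩ := by
          intro a p
          rw [← wordCons_succ a w]
          congr 1
          ext
          simp only [Fin.val_succ]
          omega
        simp only [e]
        split_ifs
        · exact hm.sum_cons _ _
        · simp
    · rw [sum_words_snoc, ← ih s hl]
      refine Finset.sum_congr rfl fun w _ => ?_
      have e : ∀ (b : S) (p : Fin n), wordSnoc w b ⟨s + p, by omega⟩ = w ⟨s + p, by omega⟩ := by
        intro b p
        rw [← wordSnoc_castSucc w b]
        rfl
      simp only [e]
      split_ifs
      · exact hm.sum_snoc _ _
      · simp

/-- Every consistent family of word probabilities comes from a measure. -/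
lemma IsWordLaw.exists_hasWordLaw {m : ∀ n : ℕ, (Fin n → Fin k) → ℝ} (hm : IsWordLaw m) :
    ∃ μ : ProbabilityMeasure (ℤ → Fin k), HasWordLaw (μ : Measure (ℤ → Fin k)) m := by
  let e : ∀ N : ℕ, (Fin (2 * N + 1) → Fin k) → ℤ → Fin k := fun N w i =>
    w ⟨min (i + N).toNat (2 * N), by omega⟩
  let ν : ℕ → Measure (ℤ → Fin k) := fun N =>
    ∑ w : Fin (2 * N + 1) → Fin k, ENNReal.ofReal (m (2 * N + 1) w) • Measure.dirac (e N w)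
  have hν : ∀ N, IsProbabilityMeasure (ν N) := by
    intro N
    refine ⟨?_⟩
    simp only [ν, Measure.coe_finsetSum, Finset.sum_apply, Measure.smul_apply, measure_univ,
      smul_eq_mul, mul_one]
    rw [← ENNReal.ofReal_sum_of_nonneg fun w _ => hm.nonneg _ _, hm.sum_eq_one, ENNReal.ofReal_one]
  let μs : ℕ → ProbabilityMeasure (ℤ → Fin k) := fun N => ⟨ν N, hν N⟩
  have hlim : Tendsto μs (hyperfilter ℕ) (nhds ((hyperfilter ℕ).map μs).lim) :=
    ((hyperfilter ℕ).map μs).le_nhds_lim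
  refine ⟨_, HasWordLaw.of_tendsto hlim fun a n v => ?_⟩
  refine tendsto_const_nhds.congr' ?_
  refine Nat.hyperfilter_le_atTop ?_
  filter_upwards [eventually_ge_atTop (a.natAbs + n)] with N hN
  have hmem : ∀ w, e N w ∈ wordCylinder a v ↔
      ∀ p : Fin n, w ⟨(a + N).toNat + p, by omega⟩ = v p := by
    intro w
    refine forall_congr' fun p => ?_
    have : min (a + ((p : ℕ) : ℤ) + N).toNat (2 * N) = (a + N).toNat + p := by omega
    simp only [e, this]
  change _ = (ν N (wordCylinder a v)).toReal
  simp only [ν, Measure.coe_finsetSum, Finset.sum_apply, Measure.smul_apply, smul_eq_mul,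
    Measure.dirac_apply' _ (measurableSet_wordCylinder a v)]
  rw [ENNReal.toReal_sum, ← hm.sum_window v (2 * N + 1) (a + N).toNat (by omega)]
  · refine Finset.sum_congr rfl fun w _ => ?_
    by_cases h : e N w ∈ wordCylinder a v
    · rw [if_pos ((hmem w).1 h), indicator_of_mem h]
      simp [ENNReal.toReal_ofReal (hm.nonneg _ _)]
    · rw [if_neg fun h' => h ((hmem w).2 h'), indicator_of_notMem h]
      simp
  · intro w _
    refine ENNReal.mul_ne_top ENNReal.ofReal_ne_top ?_
    by_cases h : e N w ∈ wordCylinder a v <;> simp [h]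

/-- A connected stationary Markov chain is ergodic. -/
lemma IsFlow.ergodic {q : Fin k → Fin k → ℝ} (hq : IsFlow q) (hpos : ∀ i, 0 < outflow q i)
    (hconn : ∀ g : Fin k → ℝ, (∀ i j, q i j ≠ 0 → g i = g j) → ∀ i j, g i = g j)
    {μ : Measure (ℤ → Fin k)} [IsProbabilityMeasure μ] (hμ : HasWordLaw μ (markovLaw q)) :
    Ergodic shiftMap μ := by
  have hinv := hμ.measurePreserving
  refine ⟨hinv, ⟨fun s hs hss => eventuallyConst_set'.2 ?_⟩⟩
  rcases eq_or_ne (μ s) 0 with h0 | h0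
  · exact Or.inl (ae_eq_empty.2 h0)
  right
  have hprob : IsProbabilityMeasure (ProbabilityTheory.cond μ s) :=
    ProbabilityTheory.cond_isProbabilityMeasure h0
  have hmp : MeasurePreserving shiftMap (ProbabilityTheory.cond μ s)
      (ProbabilityTheory.cond μ s) := by
    refine ⟨hinv.measurable, Measure.ext fun t ht => ?_⟩
    rw [Measure.map_apply hinv.measurable ht, ProbabilityTheory.cond_apply hs,
      ProbabilityTheory.cond_apply hs]
    nth_rewrite 2 [← hss]
    rw [← preimage_inter, hinv.measure_preimage (hs.inter ht).nullMeasurableSet]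
  have hle : ∀ n w, wordLaw (ProbabilityTheory.cond μ s) n w ≤
      ((μ s)⁻¹).toReal * markovLaw q n w := by
    intro n w
    rw [← hμ 0, ← hasWordLaw_wordLaw hmp 0, ← ENNReal.toReal_mul, ProbabilityTheory.cond_apply hs]
    refine ENNReal.toReal_mono
      (ENNReal.mul_ne_top (ENNReal.inv_ne_top.2 h0) (measure_ne_top _ _)) ?_
    gcongr
    exact inter_subset_right
  have hlaw : HasWordLaw (ProbabilityTheory.cond μ s) (markovLaw q) := by
    intro a n w
    rw [hasWordLaw_wordLaw hmp a,
      (isWordLaw_wordLaw hmp).eq_markovLaw_of_le hq hpos hconn hle]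
  have heq := hlaw.ext hμ
  rw [ae_eq_univ, ← heq, ProbabilityTheory.cond_apply hs]
  simp

lemma isClosed_SFT (A : Fin k → Fin k → ℕ) : IsClosed (SFT A) := by
  have : SFT A = ⋂ i : ℤ, (fun x : ℤ → Fin k => A (x i) (x (i + 1))) ⁻¹' {1} := by
    ext x
    simp [SFT]
  rw [this]
  refine isClosed_iInter fun i => ?_
  have hc : Continuous fun x : ℤ → Fin k => (x i, x (i + 1)) :=
    (continuous_apply i).prodMk (continuous_apply (i + 1))
  exact (isClosed_discrete _).preimage
    ((continuous_of_discreteTopology (f := fun p : Fin k × Fin k => A p.1 p.2)).comp hc)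

lemma mem_wordCylinder_two {a : ℤ} {i j : Fin k} {x : ℤ → Fin k} :
    x ∈ wordCylinder a (wordSnoc (fun _ : Fin 1 => i) j) ↔ x a = i ∧ x (a + 1) = j := by
  have h0 : wordSnoc (fun _ : Fin 1 => i) j 0 = i := wordSnoc_castSucc _ j 0
  have h1 : wordSnoc (fun _ : Fin 1 => i) j 1 = j := wordSnoc_last _ j
  rw [wordCylinder, mem_ofPred_eq, Fin.forall_fin_two, h0, h1]
  simp

lemma HasWordLaw.invProbOn {A : Fin k → Fin k → ℕ} {μ : Measure (ℤ → Fin k)}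
    [IsProbabilityMeasure μ] {m : ∀ n : ℕ, (Fin n → Fin k) → ℝ} (hμ : HasWordLaw μ m)
    (hA : ∀ i j, A i j ≠ 1 → m 2 (wordSnoc (fun _ => i) j) = 0) : InvProbOn A μ := by
  refine ⟨inferInstance, hμ.measurePreserving, ?_⟩
  rw [← prob_compl_eq_zero_iff (isClosed_SFT A).measurableSet]
  refine measure_mono_null (t := ⋃ (a : ℤ), ⋃ p ∈ {p : Fin k × Fin k | A p.1 p.2 ≠ 1},
    wordCylinder a (wordSnoc (fun _ : Fin 1 => p.1) p.2)) (fun x hx => ?_) ?_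
  · simp only [SFT, mem_compl_iff, mem_ofPred_eq, not_forall] at hx
    obtain ⟨a, ha⟩ := hx
    exact mem_iUnion.2 ⟨a, mem_iUnion₂.2 ⟨(x a, x (a + 1)), ha, mem_wordCylinder_two.2 ⟨rfl, rfl⟩⟩⟩
  · refine measure_iUnion_null fun a => (measure_biUnion_null_iff (to_countable _)).2 fun p hp => ?_
    have := hμ a 2 (wordSnoc (fun _ => p.1) p.2)
    rw [hA _ _ hp, ENNReal.toReal_eq_zero_iff] at this
    exact this.resolve_right (measure_ne_top _ _)

lemma InvProbOn.wordLaw_two_eq_zero {A : Fin k → Fin k → ℕ} {μ : Measure (ℤ → Fin k)}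
    (hμ : InvProbOn A μ) {i j : Fin k} (hA : A i j ≠ 1) :
    wordLaw μ 2 (wordSnoc (fun _ => i) j) = 0 := by
  obtain ⟨h1, h2, h3⟩ := hμ
  rw [← prob_compl_eq_zero_iff (isClosed_SFT A).measurableSet] at h3
  rw [← hasWordLaw_wordLaw h2 0, measure_mono_null _ h3, ENNReal.toReal_zero]
  intro x hx hx'
  obtain ⟨rfl, rfl⟩ := mem_wordCylinder_two.1 hx
  exact hA (hx' 0)

end ShiftSpace

section Perron

variable {S : Type*} [Fintype S]

open Matrix in
/-- An irreducible nonnegative matrix has a positive right eigenvector. -/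
lemma exists_pos_eigenvector [DecidableEq S] [Nonempty S] (B : Matrix S S ℝ)
    (hB : ∀ i j, 0 ≤ B i j) (hirr : ∀ i j, ∃ m : ℕ, 0 < (B ^ m) i j) :
    ∃ (ρ : ℝ) (r : S → ℝ), (∀ i, 0 < r i) ∧ B *ᵥ r = ρ • r := by
  have hBp : ∀ (m : ℕ) i j, 0 ≤ (B ^ m) i j := by
    intro m
    induction m with
    | zero =>
      intro i j
      rw [pow_zero, Matrix.one_apply]
      split_ifs <;> norm_num
    | succ m ih =>
      intro i j
      rw [pow_succ, Matrix.mul_apply]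
      exact Finset.sum_nonneg fun l _ => mul_nonneg (ih _ _) (hB _ _)
  choose m hm using hirr
  set M : Matrix S S ℝ := ∑ p : S × S, B ^ m p.1 p.2 with hM
  have hMpos : ∀ i j, 0 < M i j := by
    intro i j
    rw [hM, Matrix.sum_apply]
    exact Finset.sum_pos' (fun p _ => hBp _ _ _) ⟨(i, j), Finset.mem_univ _, hm i j⟩
  have hcomm : B * M = M * B := by
    rw [hM, Finset.mul_sum, Finset.sum_mul]
    exact Finset.sum_congr rfl fun p _ => (Commute.self_pow B _)
  have hMv : ∀ x : S → ℝ, (∀ i, 0 ≤ x i) → x ≠ 0 → ∀ i, 0 < (M *ᵥ x) i := by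
    intro x hx hx0 i
    obtain ⟨j, hj⟩ := Function.ne_iff.1 hx0
    exact Finset.sum_pos' (fun j _ => mul_nonneg (hMpos i j).le (hx j))
      ⟨j, Finset.mem_univ _, mul_pos (hMpos i j) (lt_of_le_of_ne (hx j) (Ne.symm hj))⟩
  set C : ℝ := ∑ i, ∑ j, B i j with hC
  have hC0 : 0 ≤ C := Finset.sum_nonneg fun i _ => Finset.sum_nonneg fun j _ => hB i j
  have hbound : ∀ (ρ : ℝ) (x : S → ℝ), x ∈ stdSimplex ℝ S → (∀ i, ρ * x i ≤ (B *ᵥ x) i) →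
      ρ ≤ C := by
    intro ρ x hx h
    calc ρ = ∑ i, ρ * x i := by rw [← Finset.mul_sum, hx.2, mul_one]
      _ ≤ ∑ i, (B *ᵥ x) i := Finset.sum_le_sum fun i _ => h i
      _ ≤ C := Finset.sum_le_sum fun i _ => Finset.sum_le_sum fun j _ =>
          mul_le_of_le_one_right (hB i j)
            (hx.2 ▸ Finset.single_le_sum (fun j _ => hx.1 j) (Finset.mem_univ j))
  set K : Set (ℝ × (S → ℝ)) :=
    (Icc 0 C ×ˢ stdSimplex ℝ S) ∩ {p | ∀ i, p.1 * p.2 i ≤ (B *ᵥ p.2) i} with hK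
  have hKc : IsCompact K := by
    refine (isCompact_Icc.prod (isCompact_stdSimplex ℝ S)).inter_right ?_
    rw [ofPred_forall]
    refine isClosed_iInter fun i => isClosed_le (by fun_prop) ?_
    exact (continuous_apply i).comp (Continuous.matrix_mulVec continuous_const continuous_snd)
  have hKne : K.Nonempty := by
    obtain ⟨i⟩ := ‹Nonempty S›
    refine ⟨(0, Pi.single i 1), ⟨⟨le_rfl, hC0⟩, single_mem_stdSimplex ℝ i⟩, fun j => ?_⟩
    simp only [zero_mul]
    exact Finset.sum_nonneg fun l _ => mul_nonneg (hB _ _) ((single_mem_stdSimplex ℝ i).1 l)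
  obtain ⟨⟨ρ, x⟩, ⟨⟨⟨hρ0, hρC⟩, hx⟩, hle⟩, hmax⟩ :=
    hKc.exists_isMaxOn hKne continuous_fst.continuousOn
  simp only at hρ0 hρC hx
  have hx0 : x ≠ 0 := by
    rintro rfl
    simpa using hx.2
  have heig : B *ᵥ x = ρ • x := by
    by_contra hne
    set d : S → ℝ := B *ᵥ x - ρ • x with hd
    have hd0 : d ≠ 0 := sub_ne_zero.2 hne
    have hdn : ∀ i, 0 ≤ d i := fun i => sub_nonneg.2 (hle i)
    set y : S → ℝ := M *ᵥ x with hy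
    have hypos := hMv x hx.1 hx0
    have hdpos := hMv d hdn hd0
    have hBy : B *ᵥ y - ρ • y = M *ᵥ d := by
      rw [hd, Matrix.mulVec_sub, Matrix.mulVec_smul, hy, Matrix.mulVec_mulVec,
        Matrix.mulVec_mulVec, hcomm]
    obtain ⟨i₀, hi₀⟩ := Finite.exists_min fun i => (M *ᵥ d) i / y i
    set ε : ℝ := (M *ᵥ d) i₀ / y i₀ with hε
    have hεpos : 0 < ε := div_pos (hdpos i₀) (hypos i₀)
    have hs : 0 < ∑ i, y i := Finset.sum_pos (fun i _ => hypos i) Finset.univ_nonempty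
    set z : S → ℝ := (∑ i, y i)⁻¹ • y with hz
    have hzs : z ∈ stdSimplex ℝ S := by
      refine ⟨fun i => mul_nonneg (inv_nonneg.2 hs.le) (hypos i).le, ?_⟩
      simp only [hz, Pi.smul_apply, smul_eq_mul]
      rw [← Finset.mul_sum, inv_mul_cancel₀ hs.ne']
    have hzle : ∀ i, (ρ + ε) * z i ≤ (B *ᵥ z) i := by
      intro i
      rw [hz, Matrix.mulVec_smul, Pi.smul_apply, Pi.smul_apply, smul_eq_mul, smul_eq_mul,
        mul_left_comm]
      refine mul_le_mul_of_nonneg_left ?_ (inv_nonneg.2 hs.le)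
      have h1 := congrFun hBy i
      have h2 := (le_div_iff₀ (hypos i)).1 (hi₀ i)
      simp only [Pi.sub_apply, Pi.smul_apply, smul_eq_mul] at h1
      linarith
    have hmem : (ρ + ε, z) ∈ K :=
      ⟨⟨⟨by simp only; linarith, hbound _ _ hzs hzle⟩, hzs⟩, hzle⟩
    have := hmax hmem
    simp only [mem_ofPred_eq] at this
    linarith
  have hpow : ∀ m : ℕ, (B ^ m) *ᵥ x = ρ ^ m • x := by
    intro m
    induction m with
    | zero => simp
    | succ m ih =>
      rw [pow_succ, ← Matrix.mulVec_mulVec, heig, Matrix.mulVec_smul, ih, smul_smul, pow_succ,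
        mul_comm]
  refine ⟨ρ, x, fun i => lt_of_le_of_ne (hx.1 i) fun h => ?_, heig⟩
  have h1 := hMv x hx.1 hx0 i
  rw [hM, Matrix.sum_mulVec, Finset.sum_apply] at h1
  simp [hpow, ← h] at h1

variable {A : S → S → ℕ}

lemma matPow_eq_pow [DecidableEq S] (m : ℕ) (i j : S) :
    (matPow A m i j : ℝ) = ((Matrix.of fun i j => (A i j : ℝ)) ^ m) i j := by
  induction m generalizing j with
  | zero =>
    rw [pow_zero, Matrix.one_apply, matPow]
    push_cast
    congr
  | succ m ih =>
    rw [pow_succ, Matrix.mul_apply, matPow]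
    push_cast
    exact Finset.sum_congr rfl fun l _ => by rw [ih, Matrix.of_apply]

lemma IrreducibleMat.exists_ne_zero (hirr : IrreducibleMat A) (i : S) : ∃ j, A i j ≠ 0 := by
  by_contra! h
  have key : ∀ m j, matPow A (m + 1) i j = 0 := by
    intro m
    induction m with
    | zero =>
      intro j
      refine Finset.sum_eq_zero fun r _ => ?_
      rcases eq_or_ne i r with rfl | hr
      · rw [h, mul_zero]
      · simp [matPow, hr]
    | succ m ih =>
      intro j
      refine Finset.sum_eq_zero fun r _ => ?_
      rw [ih, zero_mul]
  obtain ⟨m, hm, hpos⟩ := hirr i i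
  obtain ⟨m, rfl⟩ := Nat.exists_eq_add_of_le' hm
  exact hpos.ne' (key m i)

lemma IrreducibleMat.eq_of_forall (hirr : IrreducibleMat A) {β : Type*} {g : S → β}
    (hg : ∀ i j, A i j ≠ 0 → g i = g j) (i j : S) : g i = g j := by
  have key : ∀ m j, matPow A m i j ≠ 0 → g i = g j := by
    intro m
    induction m with
    | zero =>
      intro j h
      by_contra hne
      refine h (if_neg ?_)
      rintro rfl
      exact hne rfl
    | succ m ih =>
      intro j h
      obtain ⟨r, -, hr⟩ := Finset.exists_ne_zero_of_sum_ne_zero h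
      exact (ih r (left_ne_zero_of_mul hr)).trans (hg _ _ (right_ne_zero_of_mul hr))
  obtain ⟨m, -, hm⟩ := hirr i j
  exact key m j hm.ne'

end Perron

section Flow

variable {S : Type*} [Fintype S]

/-- A self-map of a finite set carries a flow with zero entropy. -/
lemma exists_isFlow_entropyRate_eq_zero [Nonempty S] (f : S → S) :
    ∃ q : S → S → ℝ, IsFlow q ∧ (∀ i j, q i j ≠ 0 → j = f i) ∧ entropyRate q = 0 := by
  classical
  have hne : (Function.periodicPts f).Nonempty := by
    obtain ⟨x⟩ := ‹Nonempty S›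
    obtain ⟨a, b, hab, h⟩ := Finite.exists_ne_map_eq_of_infinite fun n : ℕ => f^[n] x
    wlog hlt : a < b generalizing a b
    · exact this b a hab.symm h.symm (by omega)
    refine ⟨f^[a] x, Function.mem_periodicPts.2 ⟨b - a, by omega, ?_⟩⟩
    rw [Function.IsPeriodicPt, Function.IsFixedPt, ← Function.iterate_add_apply,
      Nat.sub_add_cancel hlt.le]
    exact h.symm
  set P : Finset S := Finset.univ.filter (· ∈ Function.periodicPts f) with hP
  have hmemP : ∀ i, i ∈ P ↔ i ∈ Function.periodicPts f := fun i => by simp [hP]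
  have hcard : (P.card : ℝ) ≠ 0 := by
    obtain ⟨x, hx⟩ := hne
    exact_mod_cast (Finset.card_pos.2 ⟨x, (hmemP x).2 hx⟩).ne'
  set p : S → ℝ := fun i => if i ∈ P then (P.card : ℝ)⁻¹ else 0 with hp
  have hp0 : ∀ i, 0 ≤ p i := fun i => by
    simp only [hp]
    split_ifs <;> positivity
  have hout : ∀ i, ∑ j, (if j = f i then p i else 0) = p i := fun i => by simp
  refine ⟨fun i j => if j = f i then p i else 0, ⟨fun i j => ?_, ?_, fun j => ?_⟩,
    fun i j h => ?_, ?_⟩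
  · split_ifs
    exacts [hp0 i, le_rfl]
  · simp only [hout]
    simp only [hp]
    rw [← Finset.sum_filter, Finset.filter_mem_eq_inter, Finset.univ_inter, Finset.sum_const,
      nsmul_eq_mul, mul_inv_cancel₀ hcard]
  · rw [hout]
    have hbij := Function.bijOn_periodicPts (f := f)
    by_cases hj : j ∈ Function.periodicPts f
    · obtain ⟨i, hi, rfl⟩ := hbij.surjOn hj
      rw [Finset.sum_eq_single i]
      · simp [hp, hmemP, hi, hj]
      · intro i' _ hne'
        rw [ite_eq_right_iff]
        intro h
        refine if_neg fun hi' => hne' ?_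
        exact hbij.injOn ((hmemP i').1 hi') hi h.symm
      · simp
    · have : p j = 0 := if_neg fun h => hj ((hmemP j).1 h)
      rw [this]
      refine Finset.sum_eq_zero fun i _ => ?_
      rw [ite_eq_right_iff]
      rintro rfl
      exact if_neg fun hi => hj (hbij.mapsTo ((hmemP i).1 hi))
  · by_contra hne'
    exact h (if_neg hne')
  · have h1 : ∀ i j, negMulLog (if j = f i then p i else 0) =
        if j = f i then negMulLog (p i) else 0 := by
      intro i j
      split_ifs <;> simp
    have h2 : outflow (fun i j => if j = f i then p i else 0) = p := funext hout
    simp [entropyRate, h1, h2]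

lemma IsFlow.convexCombination {q₀ q₁ : S → S → ℝ} (h₀ : IsFlow q₀) (h₁ : IsFlow q₁) {t : ℝ}
    (ht : t ∈ Icc (0 : ℝ) 1) : IsFlow fun i j => (1 - t) * q₀ i j + t * q₁ i j where
  nonneg i j := add_nonneg (mul_nonneg (by linarith [ht.2]) (h₀.nonneg i j))
    (mul_nonneg ht.1 (h₁.nonneg i j))
  sum_eq_one := by
    simp only [Finset.sum_add_distrib, ← Finset.mul_sum, h₀.sum_eq_one, h₁.sum_eq_one]
    ring
  balance j := by
    simp only [Finset.sum_add_distrib, ← Finset.mul_sum, h₀.balance, h₁.balance]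

lemma outflow_convexCombination (q₀ q₁ : S → S → ℝ) (t : ℝ) (i : S) :
    outflow (fun i j => (1 - t) * q₀ i j + t * q₁ i j) i =
      (1 - t) * outflow q₀ i + t * outflow q₁ i := by
  simp only [outflow, Finset.sum_add_distrib, ← Finset.mul_sum]

variable {X : Type*} [TopologicalSpace X] {s : Set X} {q : X → S → S → ℝ}

lemma continuousOn_outflow (hc : ∀ i j, ContinuousOn (fun x => q x i j) s) (i : S) :
    ContinuousOn (fun x => outflow (q x) i) s :=
  continuousOn_finsetSum _ fun j _ => hc i j

lemma continuousOn_entropyRate (hc : ∀ i j, ContinuousOn (fun x => q x i j) s) :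
    ContinuousOn (fun x => entropyRate (q x)) s :=
  (continuousOn_finsetSum _ fun i _ => continuousOn_finsetSum _ fun j _ =>
    continuous_negMulLog.comp_continuousOn (hc i j)).sub
    (continuousOn_finsetSum _ fun i _ =>
      continuous_negMulLog.comp_continuousOn (continuousOn_outflow hc i))

lemma continuousOn_markovLaw (hq : ∀ x ∈ s, IsFlow (q x))
    (hc : ∀ i j, ContinuousOn (fun x => q x i j) s) (n : ℕ) (w : Fin n → S) :
    ContinuousOn (fun x => markovLaw (q x) n w) s := by
  cases n with
  | zero => exact continuousOn_const
  | succ n =>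
    intro x hx
    by_cases h : ∃ i, outflow (q x) (w i) = 0
    · obtain ⟨i, hi⟩ := h
      have h0 : markovLaw (q x) (n + 1) w = 0 :=
        le_antisymm (hi ▸ (hq x hx).markovLaw_le_outflow n w i) ((hq x hx).markovLaw_nonneg _ _)
      have hlim := continuousOn_outflow hc (w i) x hx
      rw [ContinuousWithinAt, hi] at hlim
      rw [ContinuousWithinAt, h0]
      refine squeeze_zero' ?_ ?_ hlim
      · filter_upwards [self_mem_nhdsWithin] with y hy using (hq y hy).markovLaw_nonneg _ _
      · filter_upwards [self_mem_nhdsWithin] with y hy using (hq y hy).markovLaw_le_outflow n w i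
    · push Not at h
      refine (continuousOn_outflow hc (w 0) x hx).mul ?_
      refine tendsto_finsetProd _ fun i _ => ?_
      exact (hc _ _ x hx).div (continuousOn_outflow hc _ x hx) (h _)

end Flow

lemma isAdmissible_succ_iff {S : Type*} {A : S → S → ℕ} {n : ℕ} {w : Fin (n + 1) → S} :
    IsAdmissible A w ↔ ∀ i : Fin n, A (w i.castSucc) (w i.succ) = 1 :=
  ⟨fun h i => h i (by omega), fun h i hi => h ⟨i, by omega⟩⟩

section Parry

variable {S : Type*} [Fintype S] {A : S → S → ℕ}

/-- The number `ρ` is a positive eigenvalue of `A` with positive left and right eigenvectors `l`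
and `r`, normalized against each other. -/
structure IsPerron (A : S → S → ℕ) (ρ : ℝ) (l r : S → ℝ) : Prop where
  pos : 0 < ρ
  left_pos : ∀ i, 0 < l i
  right_pos : ∀ i, 0 < r i
  sum_eq_one : ∑ i, l i * r i = 1
  right_eq : ∀ i, ∑ j, A i j * r j = ρ * r i
  left_eq : ∀ j, ∑ i, l i * A i j = ρ * l j

/-- Positive left and right eigenvectors of an irreducible matrix. -/
lemma IrreducibleMat.exists_eigenvectors [Nonempty S] (hirr : IrreducibleMat A) :
    ∃ (ρ : ℝ) (l r : S → ℝ), IsPerron A ρ l r := by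
  classical
  set B : Matrix S S ℝ := Matrix.of fun i j => (A i j : ℝ) with hB
  obtain ⟨ρ, r, hr, hρ⟩ := exists_pos_eigenvector B (fun i j => Nat.cast_nonneg _) fun i j => by
    obtain ⟨m, -, hm⟩ := hirr i j
    exact ⟨m, by rw [hB, ← matPow_eq_pow]; exact_mod_cast hm⟩
  obtain ⟨ρ', l, hl, hρ'⟩ := exists_pos_eigenvector B.transpose
    (fun i j => Nat.cast_nonneg (A j i)) fun i j => by
    obtain ⟨m, -, hm⟩ := hirr j i
    refine ⟨m, ?_⟩
    rw [← Matrix.transpose_pow, Matrix.transpose_apply, hB, ← matPow_eq_pow]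
    exact_mod_cast hm
  have h1 : ∀ i, ∑ j, A i j * r j = ρ * r i := fun i => congrFun hρ i
  have h2 : ∀ j, ∑ i, l i * A i j = ρ' * l j := fun j => by
    rw [← smul_eq_mul, ← Pi.smul_apply, ← hρ']
    exact Finset.sum_congr rfl fun i _ => mul_comm _ _
  have hs : 0 < ∑ i, l i * r i :=
    Finset.sum_pos (fun i _ => mul_pos (hl i) (hr i)) Finset.univ_nonempty
  have heq : ρ' = ρ := by
    refine mul_right_cancel₀ hs.ne' ?_
    calc ρ' * ∑ i, l i * r i = ∑ j, (∑ i, l i * A i j) * r j := by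
          rw [Finset.mul_sum]
          exact Finset.sum_congr rfl fun j _ => by rw [h2, mul_assoc]
      _ = ∑ i, l i * ∑ j, A i j * r j := by
          simp only [Finset.sum_mul, Finset.mul_sum, mul_assoc]
          exact Finset.sum_comm
      _ = ρ * ∑ i, l i * r i := by
          rw [Finset.mul_sum]
          exact Finset.sum_congr rfl fun j _ => by rw [h1, mul_left_comm]
  subst heq
  have hρpos : 0 < ρ' := by
    obtain ⟨i⟩ := ‹Nonempty S›
    obtain ⟨j, hj⟩ := hirr.exists_ne_zero i
    refine pos_of_mul_pos_left ?_ (hr i).le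
    rw [← h1]
    exact Finset.sum_pos' (fun j _ => mul_nonneg (Nat.cast_nonneg _) (hr j).le)
      ⟨j, Finset.mem_univ _, mul_pos (by exact_mod_cast Nat.pos_of_ne_zero hj) (hr j)⟩
  refine ⟨ρ', fun i => l i / ∑ i, l i * r i, r, hρpos, fun i => div_pos (hl i) hs, hr, ?_, h1, ?_⟩
  · simp only [div_mul_eq_mul_div]
    rw [← Finset.sum_div, div_self hs.ne']
  · intro j
    simp only [div_mul_eq_mul_div]
    rw [← Finset.sum_div, h2, mul_div_assoc]

/-- The flow of the Parry measure, given the Perron eigenvalue and eigenvectors. -/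
noncomputable def parryFlow (A : S → S → ℕ) (ρ : ℝ) (l r : S → ℝ) (i j : S) : ℝ :=
  l i * A i j * r j / ρ

variable {ρ : ℝ} {l r : S → ℝ}

lemma outflow_parryFlow (hP : IsPerron A ρ l r) (i : S) :
    outflow (parryFlow A ρ l r) i = l i * r i := by
  simp only [outflow, parryFlow, mul_assoc]
  rw [← Finset.sum_div, ← Finset.mul_sum, hP.right_eq, mul_left_comm,
    mul_div_cancel_left₀ _ hP.pos.ne']

lemma isFlow_parryFlow (hP : IsPerron A ρ l r) : IsFlow (parryFlow A ρ l r) where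
  nonneg i j := div_nonneg (mul_nonneg (mul_nonneg (hP.left_pos i).le (Nat.cast_nonneg _))
    (hP.right_pos j).le) hP.pos.le
  sum_eq_one := by
    rw [← hP.sum_eq_one]
    exact Finset.sum_congr rfl fun i _ => outflow_parryFlow hP i
  balance j := by
    refine Eq.trans ?_ (outflow_parryFlow hP j).symm
    simp only [parryFlow]
    rw [← Finset.sum_div, ← Finset.sum_mul, hP.left_eq, mul_assoc,
      mul_div_cancel_left₀ _ hP.pos.ne']

lemma parryFlow_ne_zero (hP : IsPerron A ρ l r) {i j : S} :
    parryFlow A ρ l r i j ≠ 0 ↔ A i j ≠ 0 := by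
  simp [parryFlow, hP.pos.ne', (hP.left_pos i).ne', (hP.right_pos j).ne']

lemma parryFlow_div_outflow (hP : IsPerron A ρ l r) {i j : S} (hA : A i j = 1) :
    parryFlow A ρ l r i j / outflow (parryFlow A ρ l r) i = r j / (ρ * r i) := by
  rw [outflow_parryFlow hP, parryFlow, hA, Nat.cast_one, mul_one, div_div, mul_left_comm ρ,
    mul_div_mul_left _ _ (hP.left_pos i).ne']

/-- Every stationary process on the subshift has the same information rate relative to the
Parry measure. -/
lemma IsWordLaw.sum_mul_log_parryFlow {m : ∀ n : ℕ, (Fin n → S) → ℝ} (hm : IsWordLaw m)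
    (hP : IsPerron A ρ l r)
    (hA : ∀ i j, m 2 (wordSnoc (fun _ => i) j) ≠ 0 → A i j = 1) :
    ∑ i, ∑ j, m 2 (wordSnoc (fun _ => i) j) *
      log (parryFlow A ρ l r i j / outflow (parryFlow A ρ l r) i) = -log ρ := by
  have h1 : ∀ i j, m 2 (wordSnoc (fun _ => i) j) *
      log (parryFlow A ρ l r i j / outflow (parryFlow A ρ l r) i) =
      m 2 (wordSnoc (fun _ => i) j) * log (r j) - m 2 (wordSnoc (fun _ => i) j) * log (r i) -
        m 2 (wordSnoc (fun _ => i) j) * log ρ := by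
    intro i j
    rcases eq_or_ne (m 2 (wordSnoc (fun _ => i) j)) 0 with h | h
    · simp [h]
    · rw [parryFlow_div_outflow hP (hA i j h),
        Real.log_div (hP.right_pos j).ne' (mul_pos hP.pos (hP.right_pos i)).ne',
        Real.log_mul hP.pos.ne' (hP.right_pos i).ne']
      ring
  have hsnoc : ∀ i, ∑ j, m 2 (wordSnoc (fun _ => i) j) = m 1 fun _ => i :=
    fun i => hm.sum_snoc 1 _
  have hcons : ∀ j, ∑ i, m 2 (wordSnoc (fun _ => i) j) = m 1 fun _ => j := by
    intro j
    rw [← hm.sum_cons]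
    refine Finset.sum_congr rfl fun i _ => congrArg _ ?_
    ext p
    refine Fin.lastCases ?_ (fun p => ?_) p
    · rw [wordSnoc_last, ← Fin.succ_last, wordCons_succ]
    · rw [wordSnoc_castSucc, Fin.fin_one_eq_zero p, Fin.castSucc_zero, wordCons_zero]
  have htot : ∑ i, m 1 (fun _ => i) = 1 := by
    rw [← sum_words_one, hm.sum_eq_one]
  simp only [h1, Finset.sum_sub_distrib, ← Finset.sum_mul, hsnoc, htot, one_mul]
  rw [Finset.sum_comm]
  simp only [← Finset.sum_mul, hcons]
  ring

lemma entropyRate_parryFlow (h01 : ∀ i j, A i j = 0 ∨ A i j = 1) (hP : IsPerron A ρ l r) :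
    entropyRate (parryFlow A ρ l r) = log ρ := by
  have hq := isFlow_parryFlow hP
  have := hq.isWordLaw.sum_mul_log_parryFlow hP fun i j h => by
    rw [hq.markovLaw_two, parryFlow_ne_zero hP] at h
    exact (h01 i j).resolve_left h
  simp only [hq.markovLaw_two] at this
  rw [hq.entropyRate_eq, this, neg_neg]

lemma isAdmissible_of_markovLaw_ne_zero {q : S → S → ℝ} (hqA : ∀ i j, q i j ≠ 0 → A i j = 1)
    {n : ℕ} {w : Fin n → S} (h : markovLaw q n w ≠ 0) : IsAdmissible A w := by
  cases n with
  | zero => exact fun i hi => absurd hi (by omega)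
  | succ n =>
    refine isAdmissible_succ_iff.2 fun i => hqA _ _ ?_
    have := Finset.prod_ne_zero_iff.1 (right_ne_zero_of_mul h) i (Finset.mem_univ i)
    exact fun h0 => this (by rw [h0, zero_div])

lemma markovLaw_parryFlow (hP : IsPerron A ρ l r) {n : ℕ} {w : Fin (n + 1) → S}
    (hw : IsAdmissible A w) :
    markovLaw (parryFlow A ρ l r) (n + 1) w = l (w 0) * r (w (Fin.last n)) / ρ ^ n := by
  rw [isAdmissible_succ_iff] at hw
  induction n with
  | zero =>
    simp [markovLaw, outflow_parryFlow hP]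
  | succ n ih =>
    obtain ⟨v, b, rfl⟩ := exists_eq_wordSnoc w
    have hv : ∀ i : Fin n, A (v i.castSucc) (v i.succ) = 1 := by
      intro i
      have := hw i.castSucc
      rwa [Fin.succ_castSucc, wordSnoc_castSucc, wordSnoc_castSucc] at this
    have hb := hw (Fin.last n)
    rw [Fin.succ_last, wordSnoc_castSucc, wordSnoc_last] at hb
    have h0 : wordSnoc v b 0 = v 0 := by
      rw [← Fin.castSucc_zero, wordSnoc_castSucc]
    rw [markovLaw_snoc, ih hv, parryFlow_div_outflow hP hb, wordSnoc_last, h0]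
    have := (hP.right_pos (v (Fin.last n))).ne'
    have := hP.pos.ne'
    field_simp
    ring

end Parry

section TopEntropy

variable {k : ℕ} {A : Fin k → Fin k → ℕ}

lemma IsWordLaw.wordEntropy_le_log_wordCount {m : ∀ n : ℕ, (Fin n → Fin k) → ℝ}
    (hm : IsWordLaw m) {n : ℕ} (hA : ∀ w, m n w ≠ 0 → IsAdmissible A w) :
    wordEntropy m n ≤ log (wordCount A n) := by
  classical
  have hcard : (wordCount A n : ℝ) = ((Finset.univ.filter
      fun w : Fin n → Fin k => IsAdmissible A w).card : ℝ) := by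
    rw [wordCount, Nat.card_eq_fintype_card, Fintype.card_subtype]
  have hG := (gibbs_le (p := m n)
    (r := fun w => if IsAdmissible A w then ((wordCount A n : ℝ))⁻¹ else 0) (hm.nonneg n)
    (fun w => by positivity) (fun w h => ?_) ?_).1
  · have h1 : ∀ w, m n w * (log (if IsAdmissible A w then ((wordCount A n : ℝ))⁻¹ else 0) -
        log (m n w)) = negMulLog (m n w) - m n w * log (wordCount A n) := by
      intro w
      rcases eq_or_ne (m n w) 0 with h | h
      · simp [h]
      · rw [if_pos (hA w h), Real.log_inv, negMulLog]
        ring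
    simp only [h1, Finset.sum_sub_distrib, ← Finset.sum_mul, hm.sum_eq_one, one_mul] at hG
    rw [wordEntropy]
    linarith
  · rw [if_pos (hA w h), hcard]
    refine inv_ne_zero (Nat.cast_ne_zero.2 (Finset.card_pos.2 ⟨w, ?_⟩).ne')
    simpa using hA w h
  · rw [hm.sum_eq_one, ← Finset.sum_filter, Finset.sum_const, nsmul_eq_mul, ← hcard]
    exact mul_inv_le_one

lemma topEnt_eq_log [NeZero k] (h01 : ∀ i j, A i j = 0 ∨ A i j = 1) {ρ : ℝ} {l r : Fin k → ℝ}
    (hP : IsPerron A ρ l r) : topEnt A = log ρ := by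
  classical
  have hq := isFlow_parryFlow hP
  have hqA : ∀ i j, parryFlow A ρ l r i j ≠ 0 → A i j = 1 := fun i j h =>
    (h01 i j).resolve_left ((parryFlow_ne_zero hP).1 h)
  have hle : ∀ n : ℕ, log ρ ≤ log (wordCount A (n + 1)) / (n + 1) := by
    intro n
    rw [le_div_iff₀ (by positivity), mul_comm, ← entropyRate_parryFlow h01 hP]
    exact (hq.le_wordEntropy n).trans
      (hq.isWordLaw.wordEntropy_le_log_wordCount fun w => isAdmissible_of_markovLaw_ne_zero hqA)
  obtain ⟨i₀, hi₀⟩ := Finite.exists_min l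
  obtain ⟨j₀, hj₀⟩ := Finite.exists_min r
  have hc : 0 < l i₀ * r j₀ := mul_pos (hP.left_pos _) (hP.right_pos _)
  have hcount : ∀ n : ℕ, (wordCount A (n + 1) : ℝ) * (l i₀ * r j₀ / ρ ^ n) ≤ 1 := by
    intro n
    rw [← hq.isWordLaw.sum_eq_one (n + 1), wordCount, Nat.card_eq_fintype_card,
      Fintype.card_subtype, ← nsmul_eq_mul, ← Finset.sum_const]
    refine (Finset.sum_le_sum fun w hw => ?_).trans
      (Finset.sum_le_sum_of_subset_of_nonneg (Finset.filter_subset _ _)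
        fun w _ _ => hq.markovLaw_nonneg _ w)
    rw [markovLaw_parryFlow hP (Finset.mem_filter.1 hw).2]
    have hρn := pow_pos hP.pos n
    gcongr
    · exact (hP.right_pos _).le
    · exact (hP.left_pos _).le
    · exact hi₀ _
    · exact hj₀ _
  have hub : ∀ n : ℕ, log (wordCount A (n + 1)) / (n + 1) ≤
      (-log (l i₀ * r j₀) + n * log ρ) / (n + 1) := by
    intro n
    gcongr
    rcases Nat.eq_zero_or_pos (wordCount A (n + 1)) with h0 | h0
    · have h1 := hq.isWordLaw.sum_eq_one (n + 1)
      obtain ⟨w, -, hw⟩ := Finset.exists_ne_zero_of_sum_ne_zero (h1.symm ▸ one_ne_zero)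
      have hw' := isAdmissible_of_markovLaw_ne_zero hqA hw
      rw [wordCount, Nat.card_eq_zero] at h0
      rcases h0 with h0 | h0
      · exact (h0.false ⟨w, hw'⟩).elim
      · exact (not_finite_iff_infinite.2 h0 inferInstance).elim
    · have hpos : (0 : ℝ) < wordCount A (n + 1) := by exact_mod_cast h0
      have hρn := pow_pos hP.pos n
      have := Real.log_nonpos (by positivity) (hcount n)
      rw [Real.log_mul hpos.ne' (by positivity), Real.log_div hc.ne' (by positivity),
        Real.log_pow] at this
      linarith
  exact ciInf_eq_of_tendsto hle
    (tendsto_of_tendsto_of_tendsto_of_le_of_le tendsto_const_nhds (tendsto_add_mul_div _ _) hle hub)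

end TopEntropy

section Entropy

variable {k : ℕ} {A : Fin k → Fin k → ℕ}

lemma HasWordLaw.mEntropy_eq {q : Fin k → Fin k → ℝ} (hq : IsFlow q) {μ : Measure (ℤ → Fin k)}
    (hμ : HasWordLaw μ (markovLaw q)) : mEntropy μ = entropyRate q := by
  have h : ∀ n, blockH μ n = wordEntropy (wordLaw μ) n := fun _ => rfl
  rw [mEntropy, ← hq.iInf_wordEntropy]
  simp only [h, hμ.wordLaw_eq]

lemma InvProbOn.hasWordLaw_parryFlow (hirr : IrreducibleMat A) {ρ : ℝ} {l r : Fin k → ℝ}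
    (hP : IsPerron A ρ l r) {ν : Measure (ℤ → Fin k)} (hν : InvProbOn A ν)
    (hent : mEntropy ν = log ρ) : HasWordLaw ν (markovLaw (parryFlow A ρ l r)) := by
  have hprob := hν.1
  have hm := isWordLaw_wordLaw hν.2.1
  have hmA : ∀ i j, wordLaw ν 2 (wordSnoc (fun _ => i) j) ≠ 0 → A i j = 1 := by
    intro i j h
    by_contra h'
    exact h (hν.wordLaw_two_eq_zero h')
  have hle : ∀ n : ℕ, (n + 1) * log ρ ≤ wordEntropy (wordLaw ν) (n + 1) := by
    intro n
    rw [mul_comm, ← le_div_iff₀ (by positivity), ← hent]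
    refine ciInf_le ⟨0, ?_⟩ n
    rintro _ ⟨n, rfl⟩
    exact div_nonneg (hm.wordEntropy_nonneg (n + 1)) (by positivity)
  intro a n w
  rw [hasWordLaw_wordLaw hν.2.1 a]
  refine hm.eq_markovLaw (isFlow_parryFlow hP)
    (fun i => ?_) (fun g hg => hirr.eq_of_forall fun i j h => ?_) (fun i j h => ?_)
    (hm.sum_mul_log_parryFlow hP hmA) (K := -log ρ) (fun n => ?_) n w
  · rw [outflow_parryFlow hP]
    exact mul_pos (hP.left_pos i) (hP.right_pos i)
  · exact hg i j ((parryFlow_ne_zero hP).2 h)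
  · rw [parryFlow_ne_zero hP, hmA i j h]
    exact one_ne_zero
  · linarith [hle n]

end Entropy

/-- For an irreducible `k × k` 0-1 matrix `A`, there is a path
`μ : [0,1] → M_inv(σ, Σ_A)` of shift-invariant Borel probability measures carried
by `Σ_A`, continuous for the weak* topology, such that `h_{μ(0)} = 0`, `μ(1)` is
the unique measure of maximal entropy (so `h_{μ(1)} = h_top(σ, Σ_A)`), `μ(t)` is
ergodic for every `t ∈ (0,1]`, and `t ↦ h_{μ(t)}` is continuous on `[0,1]`. -/
theorem stmt2 {k : ℕ} (hk : 1 ≤ k) (A : Fin k → Fin k → ℕ)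
    (h01 : ∀ i j, A i j = 0 ∨ A i j = 1) (hirr : IrreducibleMat A) :
    ∃ μ : ℝ → ProbabilityMeasure (ℤ → Fin k),
      (∀ t ∈ Set.Icc (0:ℝ) 1, InvProbOn A (μ t : Measure (ℤ → Fin k))) ∧
      ContinuousOn μ (Set.Icc 0 1) ∧
      mEntropy (μ 0 : Measure (ℤ → Fin k)) = 0 ∧
      mEntropy (μ 1 : Measure (ℤ → Fin k)) = topEnt A ∧
      (∀ ν : Measure (ℤ → Fin k), InvProbOn A ν → mEntropy ν = topEnt A →
        ν = (μ 1 : Measure (ℤ → Fin k))) ∧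
      (∀ t ∈ Set.Ioc (0:ℝ) 1, Ergodic shiftMap (μ t : Measure (ℤ → Fin k))) ∧
      ContinuousOn (fun t => mEntropy (μ t : Measure (ℤ → Fin k))) (Set.Icc 0 1) := by
  have : NeZero k := ⟨by omega⟩
  obtain ⟨ρ, l, r, hP⟩ := hirr.exists_eigenvectors
  set q₁ := parryFlow A ρ l r with hq₁
  have h₁ : IsFlow q₁ := isFlow_parryFlow hP
  choose f hf using hirr.exists_ne_zero
  obtain ⟨q₀, h₀, h₀f, h₀e⟩ := exists_isFlow_entropyRate_eq_zero f
  set q : ℝ → Fin k → Fin k → ℝ := fun t i j => (1 - t) * q₀ i j + t * q₁ i j with hq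
  have hq0 : q 0 = q₀ := by simp [hq]
  have hq1 : q 1 = q₁ := by simp [hq]
  have hflow : ∀ t ∈ Icc (0 : ℝ) 1, IsFlow (q t) := fun t ht => h₀.convexCombination h₁ ht
  have hcont : ∀ i j, ContinuousOn (fun t => q t i j) (Icc 0 1) := fun i j =>
    Continuous.continuousOn (by fun_prop)
  have hA : ∀ t i j, A i j ≠ 1 → q t i j = 0 := by
    intro t i j h
    have hAij : A i j = 0 := (h01 i j).resolve_right h
    have hq₁0 : q₁ i j = 0 := by
      by_contra h'
      exact (parryFlow_ne_zero hP).1 h' hAij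
    have hq₀0 : q₀ i j = 0 := by
      by_contra h'
      exact hf i (h₀f i j h' ▸ hAij)
    simp [hq, hq₀0, hq₁0]
  have hex : ∀ t, ∃ μ : ProbabilityMeasure (ℤ → Fin k), t ∈ Icc (0 : ℝ) 1 →
      HasWordLaw (μ : Measure (ℤ → Fin k)) (markovLaw (q t)) := by
    intro t
    by_cases ht : t ∈ Icc (0 : ℝ) 1
    · obtain ⟨μ, hμ⟩ := (hflow t ht).isWordLaw.exists_hasWordLaw
      exact ⟨μ, fun _ => hμ⟩
    · obtain ⟨μ, -⟩ := h₁.isWordLaw.exists_hasWordLaw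
      exact ⟨μ, fun h => absurd h ht⟩
  choose μ hμ using hex
  have hent : ∀ t ∈ Icc (0 : ℝ) 1,
      mEntropy (μ t : Measure (ℤ → Fin k)) = entropyRate (q t) :=
    fun t ht => (hμ t ht).mEntropy_eq (hflow t ht)
  have h0mem : (0 : ℝ) ∈ Icc (0 : ℝ) 1 := left_mem_Icc.2 zero_le_one
  have h1mem : (1 : ℝ) ∈ Icc (0 : ℝ) 1 := right_mem_Icc.2 zero_le_one
  have htop : topEnt A = log ρ := topEnt_eq_log h01 hP
  refine ⟨μ, fun t ht => ?_, fun t ht => ?_, ?_, ?_, fun ν hν hνe => ?_, fun t ht => ?_, ?_⟩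
  · refine (hμ t ht).invProbOn fun i j h => ?_
    rw [(hflow t ht).markovLaw_two, hA t i j h]
  · exact tendsto_of_hasWordLaw (eventually_of_mem self_mem_nhdsWithin hμ) (hμ t ht)
      fun n w => continuousOn_markovLaw hflow hcont n w t ht
  · rw [hent 0 h0mem, hq0, h₀e]
  · rw [hent 1 h1mem, hq1, htop, entropyRate_parryFlow h01 hP]
  · have hprob := hν.1
    have hν' := hν.hasWordLaw_parryFlow hirr hP (hνe.trans htop)
    have hμ1 := hμ 1 h1mem
    rw [hq1] at hμ1
    exact hν'.ext hμ1
  · have ht' : t ∈ Icc (0 : ℝ) 1 := Ioc_subset_Icc_self ht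
    refine (hflow t ht').ergodic (fun i => ?_) (fun g hg => hirr.eq_of_forall fun i j h => ?_)
      (hμ t ht')
    · rw [hq, outflow_convexCombination, hq₁, outflow_parryFlow hP]
      exact add_pos_of_nonneg_of_pos
        (mul_nonneg (by linarith [ht.2]) (h₀.outflow_nonneg i))
        (mul_pos ht.1 (mul_pos (hP.left_pos i) (hP.right_pos i)))
    · refine hg i j (ne_of_gt ?_)
      have hpos : 0 < q₁ i j :=
        lt_of_le_of_ne (h₁.nonneg i j) ((parryFlow_ne_zero hP).2 h).symm
      exact add_pos_of_nonneg_of_pos (mul_nonneg (by linarith [ht.2]) (h₀.nonneg i j))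
        (mul_pos ht.1 hpos)
  · exact (continuousOn_entropyRate hcont).congr hent
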